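/- arXiv:1204.5220 — 4 statements merged into one kernel-verified Lean document; each statement's English description precedes it below -/
import Mathlib

section
/- As ε → 0 the graph Ginzburg–Landau functionals f_ε Γ-converge, with respect to Euclidean convergence on ℝ^m, to the functional f₀ defined by f₀(u) := χ Σ_{i,j=1}^m ω_{ij} |u_i − u_j| if u ∈ V^b and f₀(u) := +∞ otherwise. Explicitly: for every sequence ε_n → 0⁺, (LB) for every u ∈ ℝ^m and every sequence u_n → u one has f₀(u) ≤ liminf_{n→∞} f_{ε_n}(u_n) (in particular if u ∉ V^b then the liminf is +∞), and (UB) for every u ∈ V^b there exists a sequence u_n → u with limsup_{n→∞} f_{ε_n}(u_n) ≤ χ Σ_{i,j=1}^m ω_{ij} |u_i − u_j|. -/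
open MeasureTheory Filter Topology ENNReal
open scoped Classical

noncomputable section

/-- The graph Ginzburg–Landau functional
`f_ε(u) = χ Σ_{i,j} ω_{ij} (u_i - u_j)² + ε⁻¹ Σ_i W(u_i)`. -/
def graphGL (m : ℕ) (ω : Fin m → Fin m → ℝ) (χ : ℝ) (W : ℝ → ℝ) (ε : ℝ)
    (u : Fin m → ℝ) : ℝ :=
  χ * ∑ i, ∑ j, ω i j * (u i - u j) ^ 2 + ε⁻¹ * ∑ i, W (u i)

/-- The limit functional `f₀(u) = χ Σ_{i,j} ω_{ij} |u_i - u_j|` on binary functions,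
`+∞` otherwise. -/
def graphGL0 (m : ℕ) (ω : Fin m → Fin m → ℝ) (χ : ℝ) (u : Fin m → ℝ) : ℝ≥0∞ :=
  if ∀ i, u i = 0 ∨ u i = 1 then ENNReal.ofReal (χ * ∑ i, ∑ j, ω i j * |u i - u j|) else ⊤

/-- On binary functions the squared and absolute differences agree. -/
lemma sq_sub_eq_abs_sub_of_binary {a b : ℝ} (ha : a = 0 ∨ a = 1) (hb : b = 0 ∨ b = 1) :
    (a - b) ^ 2 = |a - b| := by
  rcases ha with rfl | rfl <;> rcases hb with rfl | rfl <;> norm_num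

lemma graphGL_of_binary {m : ℕ} (ω : Fin m → Fin m → ℝ) (χ : ℝ) {W : ℝ → ℝ}
    (hWzero : ∀ s, W s = 0 ↔ s = 0 ∨ s = 1) (ε : ℝ) {u : Fin m → ℝ}
    (hu : ∀ i, u i = 0 ∨ u i = 1) :
    graphGL m ω χ W ε u = χ * ∑ i, ∑ j, ω i j * |u i - u j| := by
  simp [graphGL, (hWzero _).2 (hu _), sq_sub_eq_abs_sub_of_binary (hu _) (hu _)]

lemma dirichlet_le_graphGL {m : ℕ} (ω : Fin m → Fin m → ℝ) (χ : ℝ) {W : ℝ → ℝ}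
    (hWnn : ∀ s, 0 ≤ W s) {ε : ℝ} (hε : 0 < ε) (u : Fin m → ℝ) :
    χ * ∑ i, ∑ j, ω i j * (u i - u j) ^ 2 ≤ graphGL m ω χ W ε u :=
  le_add_of_nonneg_right
    (mul_nonneg (inv_nonneg.2 hε.le) (Finset.sum_nonneg fun _ _ => hWnn _))

lemma potential_le_graphGL {m : ℕ} {ω : Fin m → Fin m → ℝ} (hωnn : ∀ i j, 0 ≤ ω i j)
    {χ : ℝ} (hχ : 0 ≤ χ) {W : ℝ → ℝ} (hWnn : ∀ s, 0 ≤ W s) {ε : ℝ} (hε : 0 < ε)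
    (u : Fin m → ℝ) (i : Fin m) :
    ε⁻¹ * W (u i) ≤ graphGL m ω χ W ε u := by
  have h : W (u i) ≤ ∑ k, W (u k) :=
    Finset.single_le_sum (f := fun k => W (u k)) (fun k _ => hWnn (u k)) (Finset.mem_univ i)
  exact (mul_le_mul_of_nonneg_left h (inv_nonneg.2 hε.le)).trans <|
    le_add_of_nonneg_left <| mul_nonneg hχ <| Finset.sum_nonneg fun i _ =>
      Finset.sum_nonneg fun j _ => mul_nonneg (hωnn i j) (sq_nonneg _)

/-- As `ε → 0`, the graph Ginzburg–Landau functionals `f_ε` Γ-converge to `f₀`. -/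
theorem gamma_convergence_graphGL (m : ℕ) (ω : Fin m → Fin m → ℝ)
    (hωsymm : ∀ i j, ω i j = ω j i) (hωnn : ∀ i j, 0 ≤ ω i j) (hωdiag : ∀ i, ω i i = 0)
    (χ : ℝ) (hχ : 0 < χ)
    (W : ℝ → ℝ) (hW : ContDiff ℝ 2 W) (hWnn : ∀ s, 0 ≤ W s)
    (hWzero : ∀ s, W s = 0 ↔ s = 0 ∨ s = 1)
    (e : ℕ → ℝ) (hepos : ∀ n, 0 < e n) (helim : Tendsto e atTop (nhds 0)) :
    -- (LB)
    (∀ (u : Fin m → ℝ) (U : ℕ → Fin m → ℝ), Tendsto U atTop (nhds u) →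
      graphGL0 m ω χ u ≤
        liminf (fun n => ENNReal.ofReal (graphGL m ω χ W (e n) (U n))) atTop) ∧
    -- (UB)
    (∀ u : Fin m → ℝ, (∀ i, u i = 0 ∨ u i = 1) →
      ∃ U : ℕ → Fin m → ℝ, Tendsto U atTop (nhds u) ∧
        limsup (fun n => ENNReal.ofReal (graphGL m ω χ W (e n) (U n))) atTop ≤
          ENNReal.ofReal (χ * ∑ i, ∑ j, ω i j * |u i - u j|)) := by
  refine ⟨fun u U hU => ?_, fun u hu => ⟨fun _ => u, tendsto_const_nhds, ?_⟩⟩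
  · by_cases hu : ∀ i, u i = 0 ∨ u i = 1
    · have hcont : Continuous fun v : Fin m → ℝ =>
          ENNReal.ofReal (χ * ∑ i, ∑ j, ω i j * (v i - v j) ^ 2) :=
        ENNReal.continuous_ofReal.comp (by fun_prop)
      have hlim := ((hcont.tendsto u).comp hU).liminf_eq
      simp only [sq_sub_eq_abs_sub_of_binary (hu _) (hu _)] at hlim
      rw [graphGL0, if_pos hu, ← hlim]
      exact liminf_le_liminf (Eventually.of_forall fun n =>
        ENNReal.ofReal_le_ofReal (dirichlet_le_graphGL ω χ hWnn (hepos n) (U n)))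
    · obtain ⟨i, hi⟩ := not_forall.1 hu
      have hWpos : 0 < W (u i) := (hWnn _).lt_of_ne fun h => hi ((hWzero _).1 h.symm)
      have hWlim : Tendsto (fun n => W (U n i)) atTop (𝓝 (W (u i))) :=
        (hW.continuous.tendsto _).comp ((tendsto_pi_nhds.1 hU) i)
      have hinv : Tendsto (fun n => (e n)⁻¹) atTop atTop :=
        tendsto_inv_nhdsGT_zero.comp
          (tendsto_nhdsWithin_iff.2 ⟨helim, Eventually.of_forall hepos⟩)
      have hGL : Tendsto (fun n => graphGL m ω χ W (e n) (U n)) atTop atTop :=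
        tendsto_atTop_mono (fun n => potential_le_graphGL hωnn hχ.le hWnn (hepos n) (U n) i)
          (hinv.atTop_mul_pos hWpos hWlim)
      have htop := (ENNReal.tendsto_ofReal_atTop.comp hGL).liminf_eq
      exact le_top.trans_eq htop.symm
  · simp [graphGL_of_binary ω χ hWzero _ hu]

end
end

section
/- Assume W satisfies (W2). Let ε_n → 0⁺ and let u_n ∈ ℝ^m be a sequence such that f_{ε_n}(u_n) ≤ C for all n and some constant C > 0. Then there exists a subsequence of (u_n) converging in the Euclidean norm to some u_∞ ∈ V^b, i.e. to a vector whose entries all lie in {0,1}. -/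
open MeasureTheory Filter Topology ENNReal
open scoped Classical

noncomputable section

/-- Each potential term of the graph Ginzburg–Landau functional is controlled by its energy. -/
lemma potential_le_of_graphGL_le {m : ℕ} {ω : Fin m → Fin m → ℝ} (hω : ∀ i j, 0 ≤ ω i j)
    {χ : ℝ} (hχ : 0 ≤ χ) {W : ℝ → ℝ} (hW : ∀ s, 0 ≤ W s) {ε : ℝ} (hε : 0 < ε)
    {u : Fin m → ℝ} {C : ℝ} (h : graphGL m ω χ W ε u ≤ C) (i : Fin m) :
    W (u i) ≤ ε * C := by
  have hdir : 0 ≤ χ * ∑ i, ∑ j, ω i j * (u i - u j) ^ 2 :=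
    mul_nonneg hχ (Finset.sum_nonneg fun i _ => Finset.sum_nonneg fun j _ =>
      mul_nonneg (hω i j) (sq_nonneg _))
  have hsum : ε⁻¹ * ∑ i, W (u i) ≤ C := by
    unfold graphGL at h
    linarith
  calc W (u i) ≤ ∑ i, W (u i) :=
        Finset.single_le_sum (f := fun i => W (u i)) (fun j _ => hW _) (Finset.mem_univ i)
    _ ≤ ε * C := (inv_mul_le_iff₀ hε).1 hsum

/-- Sublevel sets of a function with quadratic growth at infinity are bounded. -/
lemma exists_abs_le_of_quadratic_growth {W : ℝ → ℝ}
    (hW2 : ∃ c > (0:ℝ), ∃ R : ℝ, ∀ s : ℝ, R ≤ |s| → c * (s ^ 2 - 1) ≤ W s) (M : ℝ) :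
    ∃ B : ℝ, ∀ s, W s ≤ M → |s| ≤ B := by
  obtain ⟨c, hc, R, hR⟩ := hW2
  refine ⟨max R (M / c + 2), fun s hs => ?_⟩
  rcases le_total |s| R with h | h
  · exact le_max_of_le_left h
  · refine le_max_of_le_right ?_
    have hsq : s ^ 2 - 1 ≤ M / c := by
      rw [le_div_iff₀' hc]
      exact (hR s h).trans hs
    nlinarith [sq_abs s, sq_nonneg (|s| - 1)]

/-- Compactness: if `W` satisfies `(W2)`, `ε_n → 0⁺` and `f_{ε_n}(u_n) ≤ C`, then a subsequence
of `(u_n)` converges to a binary vector `u_∞ ∈ V^b`. -/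
theorem compactness_graphGL (m : ℕ) (ω : Fin m → Fin m → ℝ)
    (hωsymm : ∀ i j, ω i j = ω j i) (hωnn : ∀ i j, 0 ≤ ω i j) (hωdiag : ∀ i, ω i i = 0)
    (χ : ℝ) (hχ : 0 < χ)
    (W : ℝ → ℝ) (hW : ContDiff ℝ 2 W) (hWnn : ∀ s, 0 ≤ W s)
    (hWzero : ∀ s, W s = 0 ↔ s = 0 ∨ s = 1)
    (hW2 : ∃ c > (0:ℝ), ∃ R : ℝ, ∀ s : ℝ, R ≤ |s| → c * (s ^ 2 - 1) ≤ W s)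
    (e : ℕ → ℝ) (hepos : ∀ n, 0 < e n) (helim : Tendsto e atTop (nhds 0))
    (U : ℕ → Fin m → ℝ) (C : ℝ) (hC : 0 < C)
    (hbound : ∀ n, graphGL m ω χ W (e n) (U n) ≤ C) :
    ∃ φ : ℕ → ℕ, StrictMono φ ∧ ∃ uinf : Fin m → ℝ,
      (∀ i, uinf i = 0 ∨ uinf i = 1) ∧ Tendsto (U ∘ φ) atTop (nhds uinf) := by
  have hWle : ∀ n i, W (U n i) ≤ e n * C := fun n i =>
    potential_le_of_graphGL_le hωnn hχ.le hWnn (hepos n) (hbound n) i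
  obtain ⟨E, hE⟩ := helim.bddAbove_range
  obtain ⟨B, hB⟩ := exists_abs_le_of_quadratic_growth hW2 (E * C)
  have hmem : ∀ n, U n ∈ Set.pi Set.univ fun _ : Fin m => Set.Icc (-B) B := fun n i _ =>
    abs_le.1 (hB _ ((hWle n i).trans
      (mul_le_mul_of_nonneg_right (hE (Set.mem_range_self n)) hC.le)))
  obtain ⟨u, -, φ, hφ, hu⟩ :=
    (isCompact_univ_pi fun _ : Fin m => isCompact_Icc).tendsto_subseq hmem
  refine ⟨φ, hφ, u, fun i => (hWzero _).1 (le_antisymm ?_ (hWnn _)), hu⟩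
  have hlim : Tendsto (fun n => W (U (φ n) i)) atTop (𝓝 (W (u i))) :=
    (hW.continuous.tendsto _).comp (tendsto_pi_nhds.1 hu i)
  have hzero : Tendsto (fun n => e (φ n) * C) atTop (𝓝 0) := by
    simpa using (helim.comp hφ.tendsto_atTop).mul_const C
  exact le_of_tendsto_of_tendsto' hlim hzero fun n => hWle (φ n) i

end
end

section
/- Let N_n → ∞ in ℕ and let u_n ∈ L¹(T²) be a sequence for which there is a constant C > 0 such that h_{N_n,0}(u_n) ≤ C for all n. Then there exists a subsequence (u_{n'}) and a function u ∈ BV(T²;{0,1}) such that u_{n'} → u in L¹(T²). -/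
open MeasureTheory Filter Topology ENNReal
open scoped Classical

noncomputable section

/-- Fundamental domain of the flat unit torus `T²`, identified with `[0,1)²`. -/
def Q2 : Set (ℝ × ℝ) := Set.Ico (0:ℝ) 1 ×ˢ Set.Ico (0:ℝ) 1

/-- Lebesgue measure on the torus, realized as Lebesgue measure on the fundamental domain. -/
def μT : Measure (ℝ × ℝ) := volume.restrict Q2

/-- A function on `ℝ²` represents a function on the torus `T²` iff it is `1`-periodic in
each coordinate. -/
def Periodic2 {E : Type*} (f : ℝ × ℝ → E) : Prop :=
  ∀ x : ℝ × ℝ, f (x.1 + 1, x.2) = f x ∧ f (x.1, x.2 + 1) = f x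

/-- The index of the grid square (of the `N × N` grid) a real number's fractional part lies in. -/
def gridIdx (N : ℕ) (t : ℝ) : ℕ := (⌊Int.fract t * N⌋).toNat

/-- The piecewise constant (on the squares `S_N^{i,j}`) extension of grid values `g` to the torus. -/
def extendGrid (N : ℕ) (g : ℕ → ℕ → ℝ) : ℝ × ℝ → ℝ :=
  fun x => g (gridIdx N x.1) (gridIdx N x.2)

/-- `g` represents `u ∈ A_N`: `u` agrees a.e. with the piecewise constant extension of `g`. -/
def RepGrid (N : ℕ) (u : ℝ × ℝ → ℝ) (g : ℕ → ℕ → ℝ) : Prop :=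
  u =ᵐ[μT] extendGrid N g

/-- Binary ({0,1}-valued) grid functions. -/
def IsBinaryGrid (N : ℕ) (g : ℕ → ℕ → ℝ) : Prop :=
  ∀ i < N, ∀ j < N, g i j = 0 ∨ g i j = 1

/-- Convergence in `L¹(T²)`. -/
def TendstoL1 (U : ℕ → ℝ × ℝ → ℝ) (u : ℝ × ℝ → ℝ) : Prop :=
  Tendsto (fun n => ∫⁻ x, ENNReal.ofReal |U n x - u x| ∂μT) atTop (nhds 0)

/-- The divergence of a vector field on `ℝ²`. -/
def div2 (v : ℝ × ℝ → ℝ × ℝ) (x : ℝ × ℝ) : ℝ :=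
  (fderiv ℝ v x (1, 0)).1 + (fderiv ℝ v x (0, 1)).2

/-- The (isotropic) total variation `∫_{T²} |∇u|` of `u ∈ L¹(T²)`, as supremum over `C¹`
periodic vector fields with Euclidean norm at most 1. -/
def isoTV (u : ℝ × ℝ → ℝ) : ℝ≥0∞ :=
  ⨆ (v : ℝ × ℝ → ℝ × ℝ) (_ : ContDiff ℝ 1 v ∧ Periodic2 v ∧
      ∀ x, (v x).1 ^ 2 + (v x).2 ^ 2 ≤ 1),
    ENNReal.ofReal (∫ x, u x * div2 v x ∂μT)

/-- The anisotropic total variation `∫_{T²} |u_x| + |u_y|`, as supremum over `C¹` periodic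
vector fields with max-norm at most 1. -/
def anisoTV (u : ℝ × ℝ → ℝ) : ℝ≥0∞ :=
  ⨆ (v : ℝ × ℝ → ℝ × ℝ) (_ : ContDiff ℝ 1 v ∧ Periodic2 v ∧
      ∀ x, |(v x).1| ≤ 1 ∧ |(v x).2| ≤ 1),
    ENNReal.ofReal (∫ x, u x * div2 v x ∂μT)

/-- `u ∈ BV(T²; {0,1})`: `u` takes values in `{0,1}` a.e. and has finite total variation. -/
def BV01 (u : ℝ × ℝ → ℝ) : Prop :=
  AEStronglyMeasurable u μT ∧ (∀ᵐ x ∂μT, u x = 0 ∨ u x = 1) ∧ isoTV u < ⊤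

/-- The grid cut energy of `h_{N,0}`. -/
def hEnergy (N : ℕ) (g : ℕ → ℕ → ℝ) : ℝ :=
  (N : ℝ)⁻¹ * ∑ i ∈ Finset.range N, ∑ j ∈ Finset.range N,
    (|g ((i + 1) % N) j - g i j| + |g i ((j + 1) % N) - g i j|)

/-- The functional `h_{N,0} : L¹(T²) → [0,∞]`. -/
def hN0 (N : ℕ) (u : ℝ × ℝ → ℝ) : ℝ≥0∞ :=
  ⨅ (g : ℕ → ℕ → ℝ) (_ : RepGrid N u g ∧ IsBinaryGrid N g), ENNReal.ofReal (hEnergy N g)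

/-- The limit functional `h_{∞,0}`: the anisotropic total variation on `BV(T²;{0,1})`,
`+∞` otherwise. -/
def hInf0 (u : ℝ × ℝ → ℝ) : ℝ≥0∞ := if BV01 u then anisoTV u else ⊤

lemma fract_eq_self_of_mem {t : ℝ} (ht : t ∈ Set.Ico (0:ℝ) 1) : Int.fract t = t :=
  Int.fract_eq_self.2 ht

lemma gridIdx_lt {N : ℕ} (hN : 0 < N) (t : ℝ) : gridIdx N t < N := by
  have hN' : (0:ℝ) < N := by exact_mod_cast hN
  have h1 : Int.fract t * N < N := by nlinarith [Int.fract_lt_one t]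
  have h2 : ⌊Int.fract t * N⌋ < (N : ℤ) := Int.floor_lt.2 (by exact_mod_cast h1)
  unfold gridIdx
  omega

lemma measurable_gridIdx (N : ℕ) : Measurable (gridIdx N) := by
  have h : Measurable fun t : ℝ => ⌊Int.fract t * N⌋ :=
    Int.measurable_floor.comp (measurable_fract.mul_const _)
  exact (measurable_of_countable Int.toNat).comp h

lemma gridIdx_eq_iff {N : ℕ} (hN : 0 < N) {t : ℝ} (ht : t ∈ Set.Ico (0:ℝ) 1) (k : ℕ) :
    gridIdx N t = k ↔ t ∈ Set.Ico ((k:ℝ) / N) ((k + 1 : ℝ) / N) := by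
  have hN' : (0:ℝ) < N := by exact_mod_cast hN
  have h0 : 0 ≤ t * N := mul_nonneg ht.1 hN'.le
  unfold gridIdx
  rw [fract_eq_self_of_mem ht, Int.floor_toNat, Nat.floor_eq_iff h0, Set.mem_Ico,
    div_le_iff₀ hN', lt_div_iff₀ hN']

lemma measurable_extendGrid (N : ℕ) (g : ℕ → ℕ → ℝ) : Measurable (extendGrid N g) := by
  have h : Measurable (fun p : ℕ × ℕ => g p.1 p.2) := measurable_of_countable _
  exact h.comp (((measurable_gridIdx N).comp measurable_fst).prodMk
    ((measurable_gridIdx N).comp measurable_snd))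

lemma μT_eq_prod : μT = (volume.restrict (Set.Ico (0:ℝ) 1)).prod
    (volume.restrict (Set.Ico (0:ℝ) 1)) := by
  rw [Measure.prod_restrict, ← Measure.volume_eq_prod]; rfl

instance : IsProbabilityMeasure (volume.restrict (Set.Ico (0:ℝ) 1)) :=
  ⟨by simp⟩

instance : IsProbabilityMeasure μT := by
  rw [μT_eq_prod]; infer_instance

/-- The cyclic total variation of the first `N` terms of a sequence. -/
def cyclicVar (N : ℕ) (a : ℕ → ℝ) : ℝ≥0∞ :=
  ∑ k ∈ Finset.range N, ‖a ((k + 1) % N) - a k‖ₑ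

lemma Ico_div_subset {N k : ℕ} (hN : 0 < N) (hk : k < N) :
    Set.Ico ((k:ℝ) / N) ((k + 1 : ℝ) / N) ⊆ Set.Ico (0:ℝ) 1 := by
  have hN' : (0:ℝ) < N := by exact_mod_cast hN
  have hk' : (k:ℝ) + 1 ≤ N := by exact_mod_cast hk
  exact Set.Ico_subset_Ico (by positivity) ((div_le_one hN').2 hk')

lemma lintegral_gridIdx {N : ℕ} (hN : 0 < N) (w : ℕ → ℝ≥0∞) :
    ∫⁻ t in Set.Ico (0:ℝ) 1, w (gridIdx N t) = (N : ℝ≥0∞)⁻¹ * ∑ j ∈ Finset.range N, w j := by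
  have hN' : (0:ℝ) < N := by exact_mod_cast hN
  have h : ∀ t ∈ Set.Ico (0:ℝ) 1, w (gridIdx N t) = ∑ j ∈ Finset.range N,
      (Set.Ico ((j:ℝ) / N) ((j + 1 : ℝ) / N)).indicator (fun _ => w j) t := by
    intro t ht
    rw [Finset.sum_eq_single_of_mem (gridIdx N t) (Finset.mem_range.2 (gridIdx_lt hN t)),
      Set.indicator_of_mem ((gridIdx_eq_iff hN ht _).1 rfl)]
    intro j _ hj
    exact Set.indicator_of_notMem (fun hm => hj ((gridIdx_eq_iff hN ht _).2 hm).symm) _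
  rw [setLIntegral_congr_fun measurableSet_Ico h,
    lintegral_finsetSum _ (fun j _ => measurable_const.indicator measurableSet_Ico),
    Finset.mul_sum]
  refine Finset.sum_congr rfl fun j hj => ?_
  rw [lintegral_indicator_const measurableSet_Ico, Measure.restrict_apply measurableSet_Ico,
    Set.inter_eq_left.2 (Ico_div_subset hN (Finset.mem_range.1 hj)), Real.volume_Ico, mul_comm,
    show (j + 1 : ℝ) / N - j / N = (N : ℝ)⁻¹ by field_simp; ring,
    ENNReal.ofReal_inv_of_pos hN', ENNReal.ofReal_natCast]

lemma ofReal_hEnergy {N : ℕ} (hN : 0 < N) (g : ℕ → ℕ → ℝ) :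
    ENNReal.ofReal (hEnergy N g) =
      (∫⁻ y in Set.Ico (0:ℝ) 1, cyclicVar N (fun i => g i (gridIdx N y))) +
      ∫⁻ x in Set.Ico (0:ℝ) 1, cyclicVar N (g (gridIdx N x)) := by
  have hN' : (0:ℝ) < N := by exact_mod_cast hN
  rw [lintegral_gridIdx hN (fun j => cyclicVar N (fun i => g i j)),
    lintegral_gridIdx hN (fun i => cyclicVar N (g i)), ← mul_add]
  unfold hEnergy cyclicVar
  rw [ENNReal.ofReal_mul (by positivity), ENNReal.ofReal_inv_of_pos hN', ENNReal.ofReal_natCast,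
    ENNReal.ofReal_sum_of_nonneg (fun i _ => Finset.sum_nonneg fun j _ => by positivity)]
  congr 1
  rw [Finset.sum_comm (s := Finset.range N), ← Finset.sum_add_distrib]
  refine Finset.sum_congr rfl fun i _ => ?_
  rw [ENNReal.ofReal_sum_of_nonneg (fun j _ => by positivity), ← Finset.sum_add_distrib]
  refine Finset.sum_congr rfl fun j _ => ?_
  rw [ENNReal.ofReal_add (abs_nonneg _) (abs_nonneg _), Real.enorm_eq_ofReal_abs,
    Real.enorm_eq_ofReal_abs]

lemma enorm_sub_gridIdx_le {N : ℕ} (hN : 0 < N) (a : ℕ → ℝ) {δ x y : ℝ}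
    (hx : x ∈ Set.Ico (0:ℝ) 1) (hy : y ∈ Set.Ico (0:ℝ) 1) (hxy : |x - y| ≤ δ) :
    ‖a (gridIdx N x) - a (gridIdx N y)‖ₑ ≤ ∑ k ∈ Finset.range N,
      (Metric.closedBall ((k + 1 : ℝ) / N) δ).indicator
        (fun _ => ‖a ((k + 1) % N) - a k‖ₑ) x := by
  have hN' : (0:ℝ) < N := by exact_mod_cast hN
  have key : ∀ s t, s ∈ Set.Ico (0:ℝ) 1 → t ∈ Set.Ico (0:ℝ) 1 → gridIdx N s ≤ gridIdx N t →
      (∀ z, z ∈ Set.Icc s t → |x - z| ≤ δ) →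
      ‖a (gridIdx N s) - a (gridIdx N t)‖ₑ ≤ ∑ k ∈ Finset.range N,
      (Metric.closedBall ((k + 1 : ℝ) / N) δ).indicator
        (fun _ => ‖a ((k + 1) % N) - a k‖ₑ) x := by
    intro s t hs ht hst hz
    have h1 : ‖a (gridIdx N s) - a (gridIdx N t)‖ₑ ≤
        ∑ k ∈ Finset.Ico (gridIdx N s) (gridIdx N t), ‖a (k + 1) - a k‖ₑ := by
      rw [enorm_sub_rev, ← Finset.sum_Ico_sub a hst]
      exact enorm_sum_le _ _
    refine h1.trans ?_
    have hlt := gridIdx_lt hN t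
    have hsub : Finset.Ico (gridIdx N s) (gridIdx N t) ⊆ Finset.range N := fun k hk => by
      simp only [Finset.mem_Ico, Finset.mem_range] at hk ⊢; omega
    refine le_trans (Finset.sum_le_sum fun k hk => ?_)
      (Finset.sum_le_sum_of_subset_of_nonneg hsub fun _ _ _ => zero_le)
    rw [Finset.mem_Ico] at hk
    have hs1 := (gridIdx_eq_iff hN hs _).1 rfl
    have ht1 := (gridIdx_eq_iff hN ht _).1 rfl
    have hk1 : (gridIdx N s : ℝ) + 1 ≤ k + 1 := by exact_mod_cast Nat.succ_le_succ hk.1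
    have hk2 : (k : ℝ) + 1 ≤ gridIdx N t := by exact_mod_cast hk.2
    have hmem : ((k + 1 : ℝ) / N) ∈ Set.Icc s t :=
      ⟨hs1.2.le.trans (by gcongr), le_trans (by gcongr) ht1.1⟩
    rw [Set.indicator_of_mem (by rw [Metric.mem_closedBall, Real.dist_eq]; exact hz _ hmem),
      Nat.mod_eq_of_lt (by omega)]
  obtain ⟨hxy1, hxy2⟩ := abs_le.1 hxy
  rcases le_total (gridIdx N x) (gridIdx N y) with h | h
  · exact key x y hx hy h fun z hz => abs_le.2 ⟨by linarith [hz.2], by linarith [hz.1, hz.2]⟩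
  · rw [enorm_sub_rev]
    exact key y x hy hx h fun z hz => abs_le.2 ⟨by linarith [hz.2], by linarith [hz.1]⟩

lemma lintegral_enorm_sub_le {N : ℕ} (hN : 0 < N) (a : ℕ → ℝ) {δ : ℝ} {σ : ℝ → ℝ}
    (hσ : ∀ x ∈ Set.Ico (0:ℝ) 1, σ x ∈ Set.Ico (0:ℝ) 1) (hδ : ∀ x ∈ Set.Ico (0:ℝ) 1, |x - σ x| ≤ δ) :
    ∫⁻ x in Set.Ico (0:ℝ) 1, ‖a (gridIdx N x) - a (gridIdx N (σ x))‖ₑ ≤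
      ENNReal.ofReal (2 * δ) * cyclicVar N a := by
  refine (setLIntegral_mono' measurableSet_Ico fun x hx =>
    enorm_sub_gridIdx_le hN a hx (hσ x hx) (hδ x hx)).trans ?_
  rw [lintegral_finsetSum _
    (fun j _ => measurable_const.indicator Metric.isClosed_closedBall.measurableSet)]
  unfold cyclicVar
  rw [Finset.mul_sum]
  refine Finset.sum_le_sum fun k _ => ?_
  rw [lintegral_indicator_const Metric.isClosed_closedBall.measurableSet, mul_comm]
  gcongr
  exact (Measure.restrict_apply_le _ _).trans (Real.volume_closedBall _ _).le

lemma exists_minimal_sample {K N : ℕ} (hK : 0 < K) (hN : 0 < N) (W : ℕ → ℝ≥0∞) :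
    ∃ σ : ℕ → ℝ, ∀ x ∈ Set.Ico (0:ℝ) 1, σ (gridIdx K x) ∈ Set.Ico (0:ℝ) 1 ∧
      |x - σ (gridIdx K x)| ≤ (K : ℝ)⁻¹ ∧ W (gridIdx N (σ (gridIdx K x))) ≤ W (gridIdx N x) := by
  have hK' : (0:ℝ) < K := by exact_mod_cast hK
  have h : ∀ a : ℕ, ∃ s : ℝ, ∀ x ∈ Set.Ico (0:ℝ) 1, gridIdx K x = a →
      s ∈ Set.Ico (0:ℝ) 1 ∧ gridIdx K s = a ∧ W (gridIdx N s) ≤ W (gridIdx N x) := by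
    intro a
    set S : Set ℕ := gridIdx N '' {x | x ∈ Set.Ico (0:ℝ) 1 ∧ gridIdx K x = a} with hS
    have hfin : S.Finite := (Set.finite_lt_nat N).subset <| by
      rintro _ ⟨x, -, rfl⟩; exact gridIdx_lt hN x
    rcases S.eq_empty_or_nonempty with he | hne
    · refine ⟨0, fun x hx hxa => ?_⟩
      have : gridIdx N x ∈ S := ⟨x, ⟨hx, hxa⟩, rfl⟩
      simp [he] at this
    · obtain ⟨_, ⟨s, ⟨hs, hsa⟩, rfl⟩, hmin⟩ := S.exists_min_image W hfin hne
      exact ⟨s, fun x hx hxa => ⟨hs, hsa, hmin _ ⟨x, ⟨hx, hxa⟩, rfl⟩⟩⟩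
  choose σ hσ using h
  refine ⟨σ, fun x hx => ?_⟩
  obtain ⟨h1, h2, h3⟩ := hσ _ x hx rfl
  refine ⟨h1, ?_, h3⟩
  have e1 := (gridIdx_eq_iff hK hx _).1 rfl
  have e2 := (gridIdx_eq_iff hK h1 _).1 h2
  have e3 : ((gridIdx K x : ℝ) + 1) / K - gridIdx K x / K = (K : ℝ)⁻¹ := by field_simp; ring
  exact abs_le.2 ⟨by linarith [e1.1, e2.2], by linarith [e1.2, e2.1]⟩

/-- A binary grid function is `L¹`-close, with error controlled by its energy, to a binary function
on a coarser grid. -/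
lemma exists_coarse_approx {K N : ℕ} (hK : 0 < K) (hN : 0 < N) {g : ℕ → ℕ → ℝ}
    (hg : IsBinaryGrid N g) :
    ∃ s ⊆ Finset.range K ×ˢ Finset.range K,
      ∫⁻ x, ‖extendGrid N g x - extendGrid K (fun i j => if (i, j) ∈ s then 1 else 0) x‖ₑ ∂μT ≤
        ENNReal.ofReal (2 * (K : ℝ)⁻¹) * ENNReal.ofReal (hEnergy N g) := by
  obtain ⟨σ, hσ⟩ := exists_minimal_sample hK hN (fun i => cyclicVar N (g i))
  obtain ⟨τ, hτ⟩ := exists_minimal_sample hK hN (fun _ => 0)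
  set G : ℕ → ℕ → ℝ := fun a b => g (gridIdx N (σ a)) (gridIdx N (τ b)) with hG
  refine ⟨(Finset.range K ×ˢ Finset.range K).filter (fun p => G p.1 p.2 = 1),
    Finset.filter_subset _ _, ?_⟩
  have hext : extendGrid K (fun i j => if (i, j) ∈ (Finset.range K ×ˢ Finset.range K).filter
      (fun p => G p.1 p.2 = 1) then 1 else 0) = extendGrid K G := by
    funext x
    have h1 := gridIdx_lt hK x.1
    have h2 := gridIdx_lt hK x.2
    rcases hg _ (gridIdx_lt hN (σ (gridIdx K x.1))) _ (gridIdx_lt hN (τ (gridIdx K x.2)))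
      with h | h <;> simp [extendGrid, hG, h, h1, h2]
  rw [hext]
  set mid : ℝ × ℝ → ℝ := fun x => g (gridIdx N (σ (gridIdx K x.1))) (gridIdx N x.2) with hmid
  have hmeas_mid : Measurable mid := by
    have h : Measurable (fun p : ℕ × ℕ => g (gridIdx N (σ p.1)) p.2) := measurable_of_countable _
    exact h.comp (((measurable_gridIdx K).comp measurable_fst).prodMk
      ((measurable_gridIdx N).comp measurable_snd))
  have hmeas₁ : Measurable fun x => ‖extendGrid N g x - mid x‖ₑ :=
    ((measurable_extendGrid N g).sub hmeas_mid).enorm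
  have hmeas₂ : Measurable fun x => ‖mid x - extendGrid K G x‖ₑ :=
    (hmeas_mid.sub (measurable_extendGrid K G)).enorm
  have hle : ∫⁻ x, ‖extendGrid N g x - extendGrid K G x‖ₑ ∂μT ≤
      ∫⁻ x, ‖extendGrid N g x - mid x‖ₑ ∂μT + ∫⁻ x, ‖mid x - extendGrid K G x‖ₑ ∂μT := by
    rw [← lintegral_add_left hmeas₁]
    refine lintegral_mono fun x => ?_
    rw [← sub_add_sub_cancel (extendGrid N g x) (mid x) (extendGrid K G x)]
    exact enorm_add_le _ _
  refine hle.trans ?_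
  rw [ofReal_hEnergy hN, mul_add, μT_eq_prod,
    lintegral_prod_symm _ hmeas₁.aemeasurable,
    lintegral_prod _ hmeas₂.aemeasurable]
  refine add_le_add ?_ ?_
  · rw [← lintegral_const_mul' _ _ ENNReal.ofReal_ne_top]
    refine lintegral_mono fun y => ?_
    exact lintegral_enorm_sub_le hN (fun i => g i (gridIdx N y)) (σ := fun x => σ (gridIdx K x))
      (fun x hx => (hσ x hx).1) (fun x hx => (hσ x hx).2.1)
  · rw [← lintegral_const_mul' _ _ ENNReal.ofReal_ne_top]
    refine setLIntegral_mono' measurableSet_Ico fun x hx => ?_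
    refine le_trans ?_ (mul_le_mul_right (hσ x hx).2.2 _)
    exact lintegral_enorm_sub_le hN (g (gridIdx N (σ (gridIdx K x))))
      (σ := fun y => τ (gridIdx K y)) (fun y hy => (hτ y hy).1) (fun y hy => (hτ y hy).2.1)

lemma sum_range_cyclic (N : ℕ) (F : ℕ → ℝ) :
    ∑ k ∈ Finset.range N, F ((k + 1) % N) = ∑ k ∈ Finset.range N, F k := by
  cases N with
  | zero => simp
  | succ M =>
    rw [Finset.sum_range_succ, Finset.sum_range_succ', Nat.mod_self]
    congr 1
    refine Finset.sum_congr rfl fun k hk => ?_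
    rw [Nat.mod_eq_of_lt (by have := Finset.mem_range.1 hk; omega)]

/-- Summation by parts for a step function against the derivative of a periodic function. -/
lemma enorm_integral_gridIdx_mul_deriv_le {N : ℕ} (hN : 0 < N) (a : ℕ → ℝ) {w : ℝ → ℝ}
    (hw : ContDiff ℝ 1 w) (hper : w 1 = w 0) (hb : ∀ t, |w t| ≤ 1) :
    ‖∫ t in Set.Ico (0:ℝ) 1, a (gridIdx N t) * deriv w t‖ₑ ≤ cyclicVar N a := by
  have hN' : (0:ℝ) < N := by exact_mod_cast hN
  have hcont : Continuous (deriv w) := hw.continuous_deriv le_rfl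
  have hint : ∀ k : ℕ, Integrable ((Set.Ico ((k:ℝ) / N) ((k + 1 : ℝ) / N)).indicator
      (fun t => a k * deriv w t)) (volume.restrict (Set.Ico (0:ℝ) 1)) := fun k => by
    refine Integrable.indicator ?_ measurableSet_Ico
    exact ((continuous_const.mul hcont).integrableOn_Icc (a := 0) (b := 1)).mono_set
      Set.Ico_subset_Icc_self
  have hsplit : ∀ t ∈ Set.Ico (0:ℝ) 1, a (gridIdx N t) * deriv w t = ∑ k ∈ Finset.range N,
      (Set.Ico ((k:ℝ) / N) ((k + 1 : ℝ) / N)).indicator (fun t => a k * deriv w t) t := by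
    intro t ht
    rw [Finset.sum_eq_single_of_mem (gridIdx N t) (Finset.mem_range.2 (gridIdx_lt hN t)),
      Set.indicator_of_mem ((gridIdx_eq_iff hN ht _).1 rfl)]
    intro j _ hj
    exact Set.indicator_of_notMem (fun hm => hj ((gridIdx_eq_iff hN ht _).2 hm).symm) _
  have hpiece : ∀ k ∈ Finset.range N, ∫ t in Set.Ico (0:ℝ) 1,
      (Set.Ico ((k:ℝ) / N) ((k + 1 : ℝ) / N)).indicator (fun t => a k * deriv w t) t =
      a k * w ((k + 1 : ℝ) / N) - a k * w (k / N) := by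
    intro k hk
    rw [integral_indicator measurableSet_Ico, Measure.restrict_restrict measurableSet_Ico,
      Set.inter_eq_left.2 (Ico_div_subset hN (Finset.mem_range.1 hk)), integral_const_mul,
      integral_Ico_eq_integral_Ioc, ← intervalIntegral.integral_of_le (by gcongr; linarith),
      intervalIntegral.integral_deriv_eq_sub
        (fun x _ => (hw.differentiable one_ne_zero).differentiableAt)
        (hcont.intervalIntegrable _ _), mul_sub]
  have hshift : ∀ k ∈ Finset.range N, w (((k + 1) % N : ℕ) / N) = w ((k + 1 : ℝ) / N) := by
    intro k hk
    rcases (Nat.succ_le_of_lt (Finset.mem_range.1 hk)).lt_or_eq with h | h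
    · rw [Nat.mod_eq_of_lt h]; push_cast; rfl
    · have h' : (k : ℝ) + 1 = N := by exact_mod_cast h
      rw [show k + 1 = N from h, Nat.mod_self, h', div_self hN'.ne', hper]; simp
  have hcyc := sum_range_cyclic N (fun k => a k * w (k / N))
  have hsum : ∫ t in Set.Ico (0:ℝ) 1, a (gridIdx N t) * deriv w t =
      ∑ k ∈ Finset.range N, -((a ((k + 1) % N) - a k) * w ((k + 1 : ℝ) / N)) := by
    rw [setIntegral_congr_fun measurableSet_Ico hsplit, integral_finsetSum _ fun k _ => hint k,
      Finset.sum_congr rfl hpiece, Finset.sum_sub_distrib, ← hcyc, ← Finset.sum_sub_distrib]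
    refine Finset.sum_congr rfl fun k hk => ?_
    rw [hshift k hk]; ring
  rw [hsum]
  refine (enorm_sum_le _ _).trans (Finset.sum_le_sum fun k _ => ?_)
  rw [enorm_neg, enorm_mul]
  refine mul_le_of_le_one_right' ?_
  rw [Real.enorm_eq_ofReal_abs, ENNReal.ofReal_le_one]
  exact hb _

lemma Continuous.integrable_μT {f : ℝ × ℝ → ℝ} (hf : Continuous f) : Integrable f μT := by
  have h : IntegrableOn f (Set.Icc (0:ℝ) 1 ×ˢ Set.Icc (0:ℝ) 1) volume :=
    hf.continuousOn.integrableOn_compact (isCompact_Icc.prod isCompact_Icc)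
  exact h.mono_set (Set.prod_mono Set.Ico_subset_Icc_self Set.Ico_subset_Icc_self)

lemma IsBinaryGrid.extendGrid_eq {N : ℕ} (hN : 0 < N) {g : ℕ → ℕ → ℝ} (hg : IsBinaryGrid N g)
    (x : ℝ × ℝ) : extendGrid N g x = 0 ∨ extendGrid N g x = 1 :=
  hg _ (gridIdx_lt hN x.1) _ (gridIdx_lt hN x.2)

lemma IsBinaryGrid.integrable_mul {N : ℕ} (hN : 0 < N) {g : ℕ → ℕ → ℝ} (hg : IsBinaryGrid N g)
    {f : ℝ × ℝ → ℝ} (hf : Integrable f μT) : Integrable (fun x => extendGrid N g x * f x) μT := by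
  refine hf.bdd_mul (c := 1) (measurable_extendGrid N g).aestronglyMeasurable
    (Eventually.of_forall fun x => ?_)
  rcases hg.extendGrid_eq hN x with h | h <;> simp [h]

/-- The total variation of a binary grid function is bounded by its energy. -/
lemma enorm_integral_extendGrid_mul_div2_le {N : ℕ} (hN : 0 < N) {g : ℕ → ℕ → ℝ}
    (hg : IsBinaryGrid N g) {v : ℝ × ℝ → ℝ × ℝ} (hv : ContDiff ℝ 1 v) (hper : Periodic2 v)
    (hb : ∀ x, (v x).1 ^ 2 + (v x).2 ^ 2 ≤ 1) :
    ‖∫ x, extendGrid N g x * div2 v x ∂μT‖ₑ ≤ ENNReal.ofReal (hEnergy N g) := by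
  have hc : Continuous (fderiv ℝ v) := hv.continuous_fderiv one_ne_zero
  have hi₁ := hg.integrable_mul hN
    (hc.clm_apply (continuous_const (y := ((1:ℝ), (0:ℝ))))).fst.integrable_μT
  have hi₂ := hg.integrable_mul hN
    (hc.clm_apply (continuous_const (y := ((0:ℝ), (1:ℝ))))).snd.integrable_μT
  have hadd : ∫ x, extendGrid N g x * div2 v x ∂μT =
      ∫ x, extendGrid N g x * (fderiv ℝ v x (1, 0)).1 ∂μT +
      ∫ x, extendGrid N g x * (fderiv ℝ v x (0, 1)).2 ∂μT := by
    rw [← integral_add hi₁ hi₂]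
    simp only [div2, mul_add]
  have hd : ∀ x, HasFDerivAt v (fderiv ℝ v x) x := fun x =>
    (hv.differentiable one_ne_zero x).hasFDerivAt
  have hd₁ : ∀ x y : ℝ, (fderiv ℝ v (x, y) (1, 0)).1 = deriv (fun t => (v (t, y)).1) x :=
    fun x y => ((hd (x, y)).fst.comp_hasDerivAt x
      ((hasDerivAt_id x).prodMk (hasDerivAt_const x y))).deriv.symm
  have hd₂ : ∀ x y : ℝ, (fderiv ℝ v (x, y) (0, 1)).2 = deriv (fun t => (v (x, t)).2) y :=
    fun x y => ((hd (x, y)).snd.comp_hasDerivAt y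
      ((hasDerivAt_const y x).prodMk (hasDerivAt_id y))).deriv.symm
  rw [hadd]
  refine (enorm_add_le _ _).trans ?_
  rw [ofReal_hEnergy hN]
  rw [μT_eq_prod] at hi₁ hi₂ ⊢
  rw [integral_prod_symm _ hi₁, integral_prod _ hi₂]
  refine add_le_add ((enorm_integral_le_lintegral_enorm _).trans (lintegral_mono fun y => ?_))
    ((enorm_integral_le_lintegral_enorm _).trans (lintegral_mono fun x => ?_))
  · simp only [hd₁]
    refine enorm_integral_gridIdx_mul_deriv_le hN (fun i => g i (gridIdx N y))
      (w := fun t => (v (t, y)).1) ?_ ?_ ?_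
    · exact (hv.comp (contDiff_id.prodMk contDiff_const)).fst
    · simpa using congrArg Prod.fst (hper (0, y)).1
    · exact fun t => abs_le_one_iff_mul_self_le_one.2
        (by nlinarith [hb (t, y), sq_nonneg (v (t, y)).2])
  · simp only [hd₂]
    refine enorm_integral_gridIdx_mul_deriv_le hN (g (gridIdx N x))
      (w := fun t => (v (x, t)).2) ?_ ?_ ?_
    · exact (hv.comp (contDiff_const.prodMk contDiff_id)).snd
    · simpa using congrArg Prod.snd (hper (x, 0)).2
    · exact fun t => abs_le_one_iff_mul_self_le_one.2
        (by nlinarith [hb (x, t), sq_nonneg (v (x, t)).1])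

lemma continuous_div2 {v : ℝ × ℝ → ℝ × ℝ} (hv : ContDiff ℝ 1 v) : Continuous (div2 v) := by
  have hc : Continuous (fderiv ℝ v) := hv.continuous_fderiv one_ne_zero
  exact (hc.clm_apply continuous_const).fst.add (hc.clm_apply continuous_const).snd

lemma exists_grid_of_hN0_le {N : ℕ} {u : ℝ × ℝ → ℝ} {C : ℝ} (hC : 0 < C)
    (h : hN0 N u ≤ ENNReal.ofReal C) :
    ∃ g, RepGrid N u g ∧ IsBinaryGrid N g ∧
      ENNReal.ofReal (hEnergy N g) ≤ ENNReal.ofReal (C + 1) := by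
  have hlt : hN0 N u < ENNReal.ofReal (C + 1) :=
    h.trans_lt ((ENNReal.ofReal_lt_ofReal_iff (by linarith)).2 (by linarith))
  simp only [hN0, iInf_lt_iff] at hlt
  obtain ⟨g, ⟨hg, hb⟩, hle⟩ := hlt
  exact ⟨g, hg, hb, hle.le⟩

/-- `L¹` limits of binary grid functions with bounded energy are in `BV(T²; {0,1})`. -/
lemma BV01_of_tendsto {Nn : ℕ → ℕ} (hN : ∀ n, 0 < Nn n) {g : ℕ → ℕ → ℕ → ℝ}
    (hg : ∀ n, IsBinaryGrid (Nn n) (g n)) {M : ℝ≥0∞} (hM : M ≠ ⊤)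
    (hE : ∀ n, ENNReal.ofReal (hEnergy (Nn n) (g n)) ≤ M) {u : ℝ × ℝ → ℝ}
    (hu : AEStronglyMeasurable u μT)
    (hlim : ∀ᵐ x ∂μT, Tendsto (fun n => extendGrid (Nn n) (g n) x) atTop (𝓝 (u x))) :
    BV01 u := by
  refine ⟨hu, ?_, ?_⟩
  · filter_upwards [hlim] with x hx
    have hclosed : IsClosed ({0, 1} : Set ℝ) := (Set.toFinite _).isClosed
    exact hclosed.mem_of_tendsto hx (Eventually.of_forall fun n => (hg n).extendGrid_eq (hN n) x)
  · refine lt_of_le_of_lt (iSup₂_le fun v hv => ?_) hM.lt_top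
    obtain ⟨hv₁, hv₂, hv₃⟩ := hv
    have hint := (continuous_div2 hv₁).integrable_μT
    have hconv : Tendsto (fun n => ∫ x, extendGrid (Nn n) (g n) x * div2 v x ∂μT) atTop
        (𝓝 (∫ x, u x * div2 v x ∂μT)) := by
      refine tendsto_integral_of_dominated_convergence (fun x => ‖div2 v x‖)
        (fun n => ((hg n).integrable_mul (hN n) hint).aestronglyMeasurable) hint.norm
        (fun n => Eventually.of_forall fun x => ?_) ?_
      · rcases (hg n).extendGrid_eq (hN n) x with h | h <;> simp [h]
      · filter_upwards [hlim] with x hx using hx.mul_const _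
    refine le_trans ?_ (le_of_tendsto' hconv.enorm fun n =>
      (enorm_integral_extendGrid_mul_div2_le (hN n) (hg n) hv₁ hv₂ hv₃).trans (hE n))
    rw [Real.enorm_eq_ofReal_abs]
    exact ENNReal.ofReal_le_ofReal (le_abs_self _)

lemma totallyBounded_range_extendGrid {Nn : ℕ → ℕ} (hN : ∀ n, 0 < Nn n) {g : ℕ → ℕ → ℕ → ℝ}
    (hg : ∀ n, IsBinaryGrid (Nn n) (g n)) {M : ℝ≥0∞} (hM : M ≠ ⊤)
    (hE : ∀ n, ENNReal.ofReal (hEnergy (Nn n) (g n)) ≤ M)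
    (hint : ∀ n, Integrable (extendGrid (Nn n) (g n)) μT) :
    TotallyBounded (Set.range fun n => (hint n).toL1 (extendGrid (Nn n) (g n))) := by
  rw [EMetric.totallyBounded_iff]
  intro ε hε
  have hK : Tendsto (fun K : ℕ => ENNReal.ofReal (2 * (K : ℝ)⁻¹) * M) atTop (𝓝 0) := by
    have h : Tendsto (fun K : ℕ => 2 * (K : ℝ)⁻¹) atTop (𝓝 0) := by
      simpa using tendsto_inv_atTop_nhds_zero_nat.const_mul (2:ℝ)
    simpa using ENNReal.Tendsto.mul_const (ENNReal.tendsto_ofReal h) (Or.inr hM)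
  obtain ⟨K, hKε, hK0⟩ := ((hK.eventually (gt_mem_nhds hε)).and (eventually_gt_atTop 0)).exists
  set G : Finset (ℕ × ℕ) → ℕ → ℕ → ℝ := fun s i j => if (i, j) ∈ s then 1 else 0
  have hG : ∀ s, Integrable (extendGrid K (G s)) μT := fun s => by
    have hb : IsBinaryGrid K (G s) := fun i _ j _ => by
      by_cases h : (i, j) ∈ s <;> simp [G, h]
    simpa using hb.integrable_mul hK0 (integrable_const (1:ℝ))
  refine ⟨(fun s => (hG s).toL1 (extendGrid K (G s))) ''
    ((Finset.range K ×ˢ Finset.range K).powerset : Set (Finset (ℕ × ℕ))),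
    (Finset.finite_toSet _).image _, ?_⟩
  rintro _ ⟨n, rfl⟩
  obtain ⟨s, hs, hle⟩ := exists_coarse_approx hK0 (hN n) (hg n)
  simp only [Set.mem_iUnion]
  refine ⟨_, ⟨s, Finset.mem_coe.2 (Finset.mem_powerset.2 hs), rfl⟩, ?_⟩
  rw [Metric.mem_eball, Integrable.edist_toL1_toL1]
  simp only [edist_eq_enorm_sub]
  exact (hle.trans (mul_le_mul_right (hE n) _)).trans_lt hKε

/-- Compactness for `h_{N,0}`: a sequence with uniformly bounded energy along `N_n → ∞` has a
subsequence converging in `L¹(T²)` to some `u ∈ BV(T²;{0,1})`. -/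
theorem compactness_hN0 (Nn : ℕ → ℕ) (hNn : Tendsto Nn atTop atTop)
    (U : ℕ → ℝ × ℝ → ℝ) (hint : ∀ n, Integrable (U n) μT)
    (C : ℝ) (hC : 0 < C) (hbound : ∀ n, hN0 (Nn n) (U n) ≤ ENNReal.ofReal C) :
    ∃ φ : ℕ → ℕ, StrictMono φ ∧ ∃ u : ℝ × ℝ → ℝ, BV01 u ∧ TendstoL1 (U ∘ φ) u := by
  obtain ⟨n₀, hn₀⟩ := eventually_atTop.1 (hNn.eventually_gt_atTop 0)
  have hN : ∀ n, 0 < Nn (n + n₀) := fun n => hn₀ _ (Nat.le_add_left _ _)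
  choose g hrep hbin hE using fun n => exists_grid_of_hN0_le hC (hbound (n + n₀))
  have hi : ∀ n, Integrable (extendGrid (Nn (n + n₀)) (g n)) μT := fun n =>
    (hint (n + n₀)).congr (hrep n)
  have hcpt := (totallyBounded_range_extendGrid hN hbin ENNReal.ofReal_ne_top hE
    hi).closure.isCompact_of_isClosed isClosed_closure
  obtain ⟨L, -, ψ, hψ, hL⟩ := hcpt.tendsto_subseq fun n => subset_closure (Set.mem_range_self n)
  have hL1 : Tendsto (fun k => ∫⁻ x, ‖extendGrid (Nn (ψ k + n₀)) (g (ψ k)) x - L x‖ₑ ∂μT)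
      atTop (𝓝 0) := by
    refine (tendsto_iff_edist_tendsto_0.1 hL).congr fun k => ?_
    conv_lhs => rw [← Integrable.toL1_coeFn L (L1.integrable_coeFn L)]
    rw [Function.comp, Integrable.edist_toL1_toL1]
    simp only [edist_eq_enorm_sub]
  refine ⟨fun k => ψ k + n₀, fun a b hab => Nat.add_lt_add_right (hψ hab) _, L, ?_, ?_⟩
  · have hmeas : TendstoInMeasure μT (fun k => extendGrid (Nn (ψ k + n₀)) (g (ψ k))) atTop L :=
      tendstoInMeasure_of_tendsto_eLpNorm one_ne_zero
        (fun k => (hi _).aestronglyMeasurable) (L1.integrable_coeFn L).aestronglyMeasurable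
        (by simpa only [eLpNorm_one_eq_lintegral_enorm, Pi.sub_apply] using hL1)
    obtain ⟨ns, -, hae⟩ := hmeas.exists_seq_tendsto_ae
    exact BV01_of_tendsto (fun k => hN (ψ (ns k))) (fun k => hbin (ψ (ns k)))
      ENNReal.ofReal_ne_top (fun k => hE (ψ (ns k)))
      (L1.integrable_coeFn L).aestronglyMeasurable hae
  · refine hL1.congr fun k => lintegral_congr_ae ?_
    filter_upwards [hrep (ψ k)] with x hx
    rw [Function.comp, hx, Real.enorm_eq_ofReal_abs]

end
end

section
/- Let u ∈ L¹(T²) and let N_n ∈ ℕ be a sequence with N_n → ∞. Then there exists a sequence u_n ∈ L¹(T²) such that u_n → u in L¹(T²) and limsup_{n→∞} h_{N_n,0}(u_n) ≤ h_{∞,0}(u). -/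
open MeasureTheory Filter Topology ENNReal
open scoped Classical

noncomputable section

instance : IsFiniteMeasure μT := by
  refine ⟨?_⟩
  rw [μT, Measure.restrict_apply_univ, Q2, Measure.volume_eq_prod, Measure.prod_prod]
  simp

/-- The embedding of the torus into `ℝ⁴`, as a map on `ℝ²`. -/
def torusEmbedding (x : ℝ × ℝ) : (ℝ × ℝ) × (ℝ × ℝ) :=
  ((Real.cos (2 * Real.pi * x.1), Real.sin (2 * Real.pi * x.1)),
    (Real.cos (2 * Real.pi * x.2), Real.sin (2 * Real.pi * x.2)))

lemma contDiff_torusEmbedding : ContDiff ℝ 1 torusEmbedding := by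
  unfold torusEmbedding
  fun_prop

lemma periodic2_torusEmbedding : Periodic2 torusEmbedding := by
  intro x
  simp [torusEmbedding, mul_add]

lemma eq_of_cos_sin_eq {s t : ℝ} (hs : s ∈ Set.Ico (0:ℝ) 1) (ht : t ∈ Set.Ico (0:ℝ) 1)
    (hc : Real.cos (2 * Real.pi * s) = Real.cos (2 * Real.pi * t))
    (hsin : Real.sin (2 * Real.pi * s) = Real.sin (2 * Real.pi * t)) : s = t := by
  obtain ⟨k, hk⟩ := Real.Angle.angle_eq_iff_two_pi_dvd_sub.1 (Real.Angle.cos_sin_inj hc hsin)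
  have h : s - t = k := by
    have := Real.pi_pos
    apply mul_left_cancel₀ (show (2 * Real.pi) ≠ 0 by positivity)
    linarith
  have h1 : k < 1 := by
    have : (k : ℝ) < 1 := by linarith [hs.2, ht.1]
    exact_mod_cast this
  have h2 : -1 < k := by
    have : (-1 : ℝ) < k := by linarith [hs.1, ht.2]
    exact_mod_cast this
  have : k = 0 := by omega
  rw [this, Int.cast_zero] at h
  linarith

lemma injOn_torusEmbedding : Set.InjOn torusEmbedding Q2 := by
  intro x hx y hy h
  simp only [torusEmbedding, Prod.mk.injEq] at h
  exact Prod.ext (eq_of_cos_sin_eq hx.1 hy.1 h.1.1 h.1.2) (eq_of_cos_sin_eq hx.2 hy.2 h.2.1 h.2.2)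

lemma measurableSet_Q2 : MeasurableSet Q2 := measurableSet_Ico.prod measurableSet_Ico

/-- A periodic `C¹` function nearly attaining the `L¹`-norm of `f` by duality. -/
lemma exists_test_function {f : ℝ × ℝ → ℝ} (hf : Measurable f) (hf1 : ∀ x, |f x| ≤ 1)
    {ε : ℝ} (hε : 0 < ε) :
    ∃ φ : ℝ × ℝ → ℝ, ContDiff ℝ 1 φ ∧ Periodic2 φ ∧ (∀ x, |φ x| ≤ 1) ∧
      ∫ x, |f x| ∂μT ≤ ∫ x, f x * φ x ∂μT + ε := by
  set P := {x | 0 < f x} ∩ Q2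
  set M := {x | f x < 0} ∩ Q2
  have hPm : MeasurableSet P := (measurableSet_lt measurable_const hf).inter measurableSet_Q2
  have hMm : MeasurableSet M := (measurableSet_lt hf measurable_const).inter measurableSet_Q2
  have hε4 : ENNReal.ofReal (ε / 4) ≠ 0 := by simpa using by positivity
  obtain ⟨K, hKP, hKc, hK⟩ := hPm.exists_isCompact_sdiff_lt (measure_ne_top μT P) hε4
  obtain ⟨L, hLM, hLc, hL⟩ := hMm.exists_isCompact_sdiff_lt (measure_ne_top μT M) hε4
  have hcont : Continuous torusEmbedding := contDiff_torusEmbedding.continuous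
  have hdisj : Disjoint (torusEmbedding '' L) (torusEmbedding '' K) := by
    rw [Set.disjoint_left]
    rintro _ ⟨x, hx, rfl⟩ ⟨y, hy, hxy⟩
    have := injOn_torusEmbedding (hKP hy).2 (hLM hx).2 hxy
    subst this
    exact lt_asymm (show 0 < f y from (hKP hy).1) (hLM hx).1
  obtain ⟨ψ, hψL, hψK, hψ⟩ := exists_contMDiffMap_zero_one_of_isClosed (n := 1)
    (modelWithCornersSelf ℝ ((ℝ × ℝ) × (ℝ × ℝ)))
    (hLc.image hcont).isClosed (hKc.image hcont).isClosed hdisj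
  have hψd : ContDiff ℝ 1 ψ := ψ.contMDiff.contDiff
  have hφ1 : ∀ x, |2 * ψ (torusEmbedding x) - 1| ≤ 1 := fun x => by
    have := hψ (torusEmbedding x)
    rw [abs_le]; constructor <;> linarith [this.1, this.2]
  have hφc : ContDiff ℝ 1 fun x => 2 * ψ (torusEmbedding x) - 1 := by
    have := hψd.comp contDiff_torusEmbedding
    exact (contDiff_const.mul this).sub contDiff_const
  refine ⟨fun x => 2 * ψ (torusEmbedding x) - 1, hφc, ?_, hφ1, ?_⟩
  · intro x
    simp [(periodic2_torusEmbedding x).1, (periodic2_torusEmbedding x).2]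
  set B := (P \ K) ∪ (M \ L)
  have hBm : MeasurableSet B :=
    (hPm.diff hKc.measurableSet).union (hMm.diff hLc.measurableSet)
  have hBr : μT.real B ≤ ε / 2 := by
    have h1 : μT.real (P \ K) ≤ ε / 4 := ENNReal.toReal_le_of_le_ofReal (by positivity) hK.le
    have h2 : μT.real (M \ L) ≤ ε / 4 := ENNReal.toReal_le_of_le_ofReal (by positivity) hL.le
    linarith [measureReal_union_le (μ := μT) (P \ K) (M \ L)]
  have hi1 : Integrable (fun x => f x * (2 * ψ (torusEmbedding x) - 1)) μT := by
    refine Integrable.of_bound (hf.mul hφc.continuous.measurable).aestronglyMeasurable 1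
      (ae_of_all _ fun x => ?_)
    rw [Real.norm_eq_abs, abs_mul]
    exact mul_le_one₀ (hf1 x) (abs_nonneg _) (hφ1 x)
  have hi2 : Integrable (fun x => B.indicator (fun _ => (2:ℝ)) x) μT :=
    (integrable_const _).indicator hBm
  have hi3 : Integrable (fun x => |f x|) μT :=
    Integrable.of_bound hf.abs.aestronglyMeasurable 1 (ae_of_all _ fun x => by simpa using hf1 x)
  have key : ∫ x, |f x| ∂μT ≤
      ∫ x, (f x * (2 * ψ (torusEmbedding x) - 1) + B.indicator (fun _ => (2:ℝ)) x) ∂μT := by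
    refine integral_mono_ae hi3 (hi1.add hi2) ?_
    rw [μT]
    filter_upwards [ae_restrict_mem measurableSet_Q2] with x hxQ
    by_cases hxB : x ∈ B
    · have h1 : |f x * (2 * ψ (torusEmbedding x) - 1)| ≤ 1 := by
        rw [abs_mul]; exact mul_le_one₀ (hf1 x) (abs_nonneg _) (hφ1 x)
      simp only [Set.indicator_of_mem hxB]
      linarith [hf1 x, neg_le_of_abs_le h1]
    · simp only [Set.indicator_of_notMem hxB, add_zero]
      rcases lt_trichotomy (f x) 0 with h | h | h
      · have hxL : x ∈ L := by
          by_contra hc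
          exact hxB (Or.inr ⟨⟨h, hxQ⟩, hc⟩)
        have : ψ (torusEmbedding x) = 0 := hψL ⟨x, hxL, rfl⟩
        rw [this, abs_of_neg h]; linarith
      · simp [h]
      · have hxK : x ∈ K := by
          by_contra hc
          exact hxB (Or.inl ⟨⟨h, hxQ⟩, hc⟩)
        have : ψ (torusEmbedding x) = 1 := hψK ⟨x, hxK, rfl⟩
        rw [this, abs_of_pos h]; linarith
  rw [integral_add hi1 hi2, integral_indicator hBm, setIntegral_const, smul_eq_mul] at key
  linarith

/-- Integrating a `C¹` function along the segment from `x` to `x - h • e` gives a `C¹` function,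
whose derivative in direction `e` is a difference of values. -/
lemma segment_average {φ : ℝ × ℝ → ℝ} (hφ : ContDiff ℝ 1 φ) (e : ℝ × ℝ) (h : ℝ) :
    ContDiff ℝ 1 (fun x => ∫ t in (0:ℝ)..h, φ (x - t • e)) ∧
      ∀ x, fderiv ℝ (fun x => ∫ t in (0:ℝ)..h, φ (x - t • e)) x e = φ x - φ (x - h • e) := by
  have hd : Continuous (fderiv ℝ φ) := hφ.continuous_fderiv one_ne_zero
  have hdiff : Differentiable ℝ φ := hφ.differentiable one_ne_zero
  have hF : ∀ x, HasFDerivAt (fun x => ∫ t in (0:ℝ)..h, φ (x - t • e))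
      (∫ t in (0:ℝ)..h, fderiv ℝ φ (x - t • e)) x := by
    intro x
    have hcp : IsCompact (Metric.closedBall x 1 ×ˢ Set.uIcc 0 h) :=
      (isCompact_closedBall x 1).prod isCompact_uIcc
    obtain ⟨C, hC⟩ := hcp.exists_bound_of_continuousOn
      (f := fun p : (ℝ × ℝ) × ℝ => fderiv ℝ φ (p.1 - p.2 • e)) (by fun_prop)
    have hφc := hφ.continuous
    refine intervalIntegral.hasFDerivAt_integral_of_dominated_of_fderiv_le
      (F := fun x t => φ (x - t • e)) (F' := fun x t => fderiv ℝ φ (x - t • e))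
      (bound := fun _ => C)
      (Metric.closedBall_mem_nhds x one_pos) ?_ ?_ ?_ ?_ ?_ ?_
    · exact Eventually.of_forall fun y => Continuous.aestronglyMeasurable (by fun_prop)
    · exact Continuous.intervalIntegrable (by fun_prop) _ _
    · exact Continuous.aestronglyMeasurable (by fun_prop)
    · exact ae_of_all _ fun t ht y hy => hC (y, t) ⟨hy, Set.uIoc_subset_uIcc ht⟩
    · simp
    · refine ae_of_all _ fun t _ y _ => ?_
      have := (hdiff (y - t • e)).hasFDerivAt.comp y ((hasFDerivAt_id y).sub_const (t • e))
      simpa using! this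
  refine ⟨contDiff_one_iff_fderiv.2 ⟨fun x => (hF x).differentiableAt, ?_⟩, fun x => ?_⟩
  · rw [show fderiv ℝ (fun x => ∫ t in (0:ℝ)..h, φ (x - t • e)) =
      fun x => ∫ t in (0:ℝ)..h, fderiv ℝ φ (x - t • e) from funext fun x => (hF x).fderiv]
    exact intervalIntegral.continuous_parametric_intervalIntegral_of_continuous'
      (f := fun x t => fderiv ℝ φ (x - t • e)) (by fun_prop) 0 h
  · rw [(hF x).fderiv, ContinuousLinearMap.intervalIntegral_apply
      (Continuous.intervalIntegrable (by fun_prop) _ _)]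
    have hder : ∀ t ∈ Set.uIcc 0 h,
        HasDerivAt (fun t : ℝ => -φ (x - t • e)) (fderiv ℝ φ (x - t • e) e) t := by
      intro t _
      have h1 : HasDerivAt (fun t : ℝ => x - t • e) (-e) t := by
        simpa using ((hasDerivAt_id t).smul_const e).const_sub x
      have := ((hdiff (x - t • e)).hasFDerivAt.comp_hasDerivAt t h1).neg
      simpa using! this
    rw [intervalIntegral.integral_eq_sub_of_hasDerivAt hder
      (Continuous.intervalIntegrable (by fun_prop) _ _)]
    simp
    ring

lemma lintegral_Ico_add_right {F : ℝ → ℝ≥0∞} (hF : ∀ t, F (t + 1) = F t) (h : ℝ) :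
    ∫⁻ t in Set.Ico (0:ℝ) 1, F (t + h) = ∫⁻ t in Set.Ico (0:ℝ) 1, F t := by
  have h1 : ∫⁻ t in Set.Ioc h (h + 1), F t = ∫⁻ t in Set.Ioc (0:ℝ) (0 + 1), F t := by
    refine (isAddFundamentalDomain_Ioc one_pos h).setLIntegral_eq
      (isAddFundamentalDomain_Ioc one_pos 0) F ?_
    rintro ⟨g, hg⟩ x
    obtain ⟨n, rfl⟩ := AddSubgroup.mem_zmultiples_iff.1 hg
    have := (show Function.Periodic F 1 from hF).zsmul n x
    simpa [AddSubgroup.vadd_def, add_comm] using! this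
  have h2 : ∫⁻ t in Set.Ioc (0:ℝ) 1, F (t + h) = ∫⁻ t in Set.Ioc h (h + 1), F t := by
    have := (measurePreserving_add_right volume h).setLIntegral_comp_preimage_emb
      (measurableEmbedding_addRight h) F (Set.Ioc h (h + 1))
    rw [← this]
    simp
  rw [restrict_Ico_eq_restrict_Ioc, h2, h1, zero_add]

lemma lintegral_μT {F : ℝ × ℝ → ℝ≥0∞} (hF : Measurable F) :
    ∫⁻ x, F x ∂μT = ∫⁻ s in Set.Ico (0:ℝ) 1, ∫⁻ t in Set.Ico (0:ℝ) 1, F (s, t) := by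
  rw [μT, Q2, Measure.volume_eq_prod, ← Measure.prod_restrict, lintegral_prod _ hF.aemeasurable]

lemma lintegral_translate {F : ℝ × ℝ → ℝ≥0∞} (hF : Measurable F) (hp : Periodic2 F) (h : ℝ × ℝ) :
    ∫⁻ x, F (x + h) ∂μT = ∫⁻ x, F x ∂μT := by
  rw [lintegral_μT hF, lintegral_μT (F := fun x => F (x + h)) (by fun_prop)]
  rw [← lintegral_Ico_add_right (F := fun s => ∫⁻ t in Set.Ico (0:ℝ) 1, F (s, t)) ?_ h.1]
  · refine lintegral_congr fun s => ?_
    exact lintegral_Ico_add_right (F := fun t => F (s + h.1, t)) (fun t => (hp (s + h.1, t)).2) h.2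
  · exact fun s => lintegral_congr fun t => (hp (s, t)).1

lemma integral_translate {F : ℝ × ℝ → ℝ} (hF : Measurable F) (hp : Periodic2 F) {C : ℝ}
    (hC : ∀ x, |F x| ≤ C) (h : ℝ × ℝ) :
    ∫ x, F (x + h) ∂μT = ∫ x, F x ∂μT := by
  have hF' : Measurable fun x => F (x + h) := by fun_prop
  rw [integral_eq_lintegral_pos_part_sub_lintegral_neg_part
      (Integrable.of_bound hF.aestronglyMeasurable C (ae_of_all _ hC)),
    integral_eq_lintegral_pos_part_sub_lintegral_neg_part
      (Integrable.of_bound hF'.aestronglyMeasurable C (ae_of_all _ fun x => hC _)),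
    lintegral_translate (F := fun x => ENNReal.ofReal (F x)) (by fun_prop)
      (fun x => by simp [(hp x).1, (hp x).2]),
    lintegral_translate (F := fun x => ENNReal.ofReal (-F x)) (by fun_prop)
      (fun x => by simp [(hp x).1, (hp x).2])]

/-- Summation by parts: pairing the difference quotient of `w` in direction `e` with `φ`. -/
lemma integral_mul_sub_translate {w φ : ℝ × ℝ → ℝ} (hw : Measurable w) (hw1 : ∀ x, |w x| ≤ 1)
    (hwp : Periodic2 w) (hφ : Continuous φ) (hφp : Periodic2 φ) (hφ1 : ∀ x, |φ x| ≤ 1)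
    (e : ℝ × ℝ) :
    ∫ x, w x * (φ x - φ (x - e)) ∂μT = -∫ x, (w (x + e) - w x) * φ x ∂μT := by
  have hφm := hφ.measurable
  have bd : ∀ x y, |w x * φ y| ≤ 1 := fun x y => by
    rw [abs_mul]; exact mul_le_one₀ (hw1 x) (abs_nonneg _) (hφ1 y)
  have i1 : Integrable (fun x => w x * φ x) μT :=
    Integrable.of_bound (hw.mul hφm).aestronglyMeasurable 1 (ae_of_all _ fun x => bd _ _)
  have i2 : Integrable (fun x => w x * φ (x - e)) μT :=
    Integrable.of_bound (Measurable.aestronglyMeasurable (by fun_prop)) 1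
      (ae_of_all _ fun x => bd _ _)
  have i3 : Integrable (fun x => w (x + e) * φ x) μT :=
    Integrable.of_bound (Measurable.aestronglyMeasurable (by fun_prop)) 1
      (ae_of_all _ fun x => bd _ _)
  have hper : Periodic2 fun x => w x * φ (x - e) := by
    intro x
    have h1 := (hφp (x - e)).1
    have h2 := (hφp (x - e)).2
    have e1 : ((x.1 + 1, x.2) : ℝ × ℝ) - e = ((x - e).1 + 1, (x - e).2) := by
      ext <;> simp; ring
    have e2 : ((x.1, x.2 + 1) : ℝ × ℝ) - e = ((x - e).1, (x - e).2 + 1) := by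
      ext <;> simp; ring
    simp only [e1, e2, h1, h2, (hwp x).1, (hwp x).2, and_self]
  have htr := integral_translate (F := fun x => w x * φ (x - e)) (by fun_prop) hper
    (fun x => bd _ _) e
  simp only [add_sub_cancel_right] at htr
  simp only [mul_sub, sub_mul]
  rw [integral_sub i1 i2, integral_sub i3 i1, htr]
  ring

lemma periodic2_segment_average {φ : ℝ × ℝ → ℝ} (hφp : Periodic2 φ) (e : ℝ × ℝ) (h : ℝ) :
    Periodic2 fun x => ∫ t in (0:ℝ)..h, φ (x - t • e) := by
  intro x
  have e1 : ∀ t : ℝ, ((x.1 + 1, x.2) : ℝ × ℝ) - t • e = ((x - t • e).1 + 1, (x - t • e).2) :=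
    fun t => by ext <;> simp; ring
  have e2 : ∀ t : ℝ, ((x.1, x.2 + 1) : ℝ × ℝ) - t • e = ((x - t • e).1, (x - t • e).2 + 1) :=
    fun t => by ext <;> simp; ring
  simp only [e1, e2, (hφp _).1, (hφp _).2, and_self]

lemma div2_mk {f g : ℝ × ℝ → ℝ} (hf : Differentiable ℝ f) (hg : Differentiable ℝ g) (a : ℝ)
    (x : ℝ × ℝ) :
    div2 (fun x => (a * f x, a * g x)) x =
      a * (fderiv ℝ f x (1, 0) + fderiv ℝ g x (0, 1)) := by
  rw [div2, DifferentiableAt.fderiv_prodMk ((hf x).const_mul a) ((hg x).const_mul a)]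
  simp [fderiv_const_mul (hf x), fderiv_const_mul (hg x), mul_add]

/-- The anisotropic total variation controls difference quotients in the coordinate directions. -/
lemma integral_abs_translate_sub_le {w : ℝ × ℝ → ℝ} (hw : Measurable w)
    (hw01 : ∀ x, 0 ≤ w x ∧ w x ≤ 1) (hwp : Periodic2 w) {c : ℝ}
    (hc : ∀ v : ℝ × ℝ → ℝ × ℝ, ContDiff ℝ 1 v → Periodic2 v →
      (∀ x, |(v x).1| ≤ 1 ∧ |(v x).2| ≤ 1) → ∫ x, w x * div2 v x ∂μT ≤ c) (h : ℝ) :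
    ∫ x, |w (x + h • (1, 0)) - w x| ∂μT + ∫ x, |w (x + h • (0, 1)) - w x| ∂μT ≤ |h| * c := by
  rcases eq_or_ne h 0 with rfl | hh
  · have : ∀ e : ℝ × ℝ, (fun x => |w (x + (0:ℝ) • e) - w x|) = fun _ => (0:ℝ) := fun e => by simp
    simp only [this]
    simp
  have hpos : 0 < |h| := abs_pos.2 hh
  have hw1 : ∀ x, |w x| ≤ 1 := fun x => by
    rw [abs_of_nonneg (hw01 x).1]; exact (hw01 x).2
  have hdw : ∀ x y, |w x - w y| ≤ 1 := fun x y => by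
    rw [abs_le]; constructor <;> linarith [(hw01 x).1, (hw01 x).2, (hw01 y).1, (hw01 y).2]
  refine le_of_forall_pos_le_add fun ε hε => ?_
  obtain ⟨φ, hφ, hφp, hφ1, hφε⟩ := exists_test_function
    (f := fun x => w (x + h • (1, 0)) - w x) (by fun_prop) (fun x => hdw _ _) (half_pos hε)
  obtain ⟨ψ, hψ, hψp, hψ1, hψε⟩ := exists_test_function
    (f := fun x => w (x + h • (0, 1)) - w x) (by fun_prop) (fun x => hdw _ _) (half_pos hε)
  obtain ⟨hΦ, hΦd⟩ := segment_average hφ (1, 0) h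
  obtain ⟨hΨ, hΨd⟩ := segment_average hψ (0, 1) h
  have hΦp := periodic2_segment_average hφp (1, 0) h
  have hΨp := periodic2_segment_average hψp (0, 1) h
  have bound : ∀ {φ : ℝ × ℝ → ℝ}, (∀ x, |φ x| ≤ 1) → ∀ e x : ℝ × ℝ,
      |-|h|⁻¹ * ∫ t in (0:ℝ)..h, φ (x - t • e)| ≤ 1 := by
    intro φ hφ1 e x
    have := intervalIntegral.norm_integral_le_of_norm_le_const (a := 0) (b := h) (C := 1)
      (f := fun t => φ (x - t • e)) (fun t _ => hφ1 _)
    rw [Real.norm_eq_abs, sub_zero, one_mul] at this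
    rw [abs_mul, abs_neg, abs_inv, abs_abs, inv_mul_le_iff₀ hpos, mul_one]
    exact this
  have key := hc (fun x => (-|h|⁻¹ * ∫ t in (0:ℝ)..h, φ (x - t • (1, 0)),
    -|h|⁻¹ * ∫ t in (0:ℝ)..h, ψ (x - t • (0, 1))))
    ((contDiff_const.mul hΦ).prodMk (contDiff_const.mul hΨ))
    (fun x => by
      constructor
      · simp only [(hΦp x).1, (hΨp x).1]
      · simp only [(hΦp x).2, (hΨp x).2])
    (fun x => ⟨bound hφ1 _ x, bound hψ1 _ x⟩)
  have hint : ∀ {φ : ℝ × ℝ → ℝ}, Continuous φ → (∀ x, |φ x| ≤ 1) → ∀ e : ℝ × ℝ,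
      Integrable (fun x => w x * (φ x - φ (x - e))) μT := by
    intro φ hφc hφ1 e
    refine Integrable.of_bound (Measurable.aestronglyMeasurable ?_) (1 * 2) (ae_of_all _ fun x => ?_)
    · have := hφc.measurable
      fun_prop
    · rw [Real.norm_eq_abs, abs_mul]
      refine mul_le_mul (hw1 x) ?_ (abs_nonneg _) zero_le_one
      linarith [abs_sub (φ x) (φ (x - e)), hφ1 x, hφ1 (x - e)]
  simp only [div2_mk (hΦ.differentiable one_ne_zero) (hΨ.differentiable one_ne_zero), hΦd, hΨd,
    mul_left_comm _ (-|h|⁻¹)] at key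
  rw [integral_const_mul] at key
  simp only [mul_add] at key
  rw [integral_add (hint hφ.continuous hφ1 _) (hint hψ.continuous hψ1 _),
    integral_mul_sub_translate hw hw1 hwp hφ.continuous hφp hφ1,
    integral_mul_sub_translate hw hw1 hwp hψ.continuous hψp hψ1, ← neg_add, neg_mul_neg,
    inv_mul_le_iff₀ hpos] at key
  linarith

lemma lintegral_abs_translate_sub_le {w : ℝ × ℝ → ℝ} (hw : Measurable w)
    (hw01 : ∀ x, 0 ≤ w x ∧ w x ≤ 1) (hwp : Periodic2 w) {c : ℝ}
    (hc : ∀ v : ℝ × ℝ → ℝ × ℝ, ContDiff ℝ 1 v → Periodic2 v →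
      (∀ x, |(v x).1| ≤ 1 ∧ |(v x).2| ≤ 1) → ∫ x, w x * div2 v x ∂μT ≤ c) (h : ℝ) :
    ∫⁻ x, ENNReal.ofReal |w (x + h • (1, 0)) - w x| ∂μT +
      ∫⁻ x, ENNReal.ofReal |w (x + h • (0, 1)) - w x| ∂μT ≤ ENNReal.ofReal (|h| * c) := by
  have hint : ∀ e : ℝ × ℝ, Integrable (fun x => |w (x + h • e) - w x|) μT := fun e => by
    refine Integrable.of_bound (Measurable.aestronglyMeasurable ?_) 1 (ae_of_all _ fun x => ?_)
    · exact (by fun_prop : Measurable fun x => w (x + h • e) - w x).abs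
    · rw [Real.norm_eq_abs, abs_abs, abs_le]
      constructor <;> linarith [(hw01 x).1, (hw01 x).2, (hw01 (x + h • e)).1, (hw01 (x + h • e)).2]
  rw [← ofReal_integral_eq_lintegral_ofReal (hint _) (ae_of_all _ fun x => abs_nonneg _),
    ← ofReal_integral_eq_lintegral_ofReal (hint _) (ae_of_all _ fun x => abs_nonneg _),
    ← ENNReal.ofReal_add (integral_nonneg fun x => abs_nonneg _)
      (integral_nonneg fun x => abs_nonneg _)]
  exact ENNReal.ofReal_le_ofReal (integral_abs_translate_sub_le hw hw01 hwp hc h)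

/-- `L¹`-modulus of continuity under arbitrary translations. -/
lemma lintegral_abs_translate_sub_le' {w : ℝ × ℝ → ℝ} (hw : Measurable w)
    (hw01 : ∀ x, 0 ≤ w x ∧ w x ≤ 1) (hwp : Periodic2 w) {c : ℝ} (hc0 : 0 ≤ c)
    (hc : ∀ v : ℝ × ℝ → ℝ × ℝ, ContDiff ℝ 1 v → Periodic2 v →
      (∀ x, |(v x).1| ≤ 1 ∧ |(v x).2| ≤ 1) → ∫ x, w x * div2 v x ∂μT ≤ c) (k : ℝ × ℝ) :
    ∫⁻ x, ENNReal.ofReal |w (x + k) - w x| ∂μT ≤ ENNReal.ofReal ((|k.1| + |k.2|) * c) := by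
  have hm : ∀ e : ℝ × ℝ, Measurable fun x => ENNReal.ofReal |w (x + e) - w x| := fun e =>
    (by fun_prop : Measurable fun x => w (x + e) - w x).abs.ennreal_ofReal
  have h1 := le_self_add.trans (lintegral_abs_translate_sub_le hw hw01 hwp hc k.1)
  have h2 := le_add_self.trans (lintegral_abs_translate_sub_le hw hw01 hwp hc k.2)
  have hper : Periodic2 fun x => ENNReal.ofReal |w (x + k.2 • (0, 1)) - w x| := by
    intro x
    have e1 : ((x.1 + 1, x.2) : ℝ × ℝ) + k.2 • (0, 1) =
        ((x + k.2 • ((0:ℝ), (1:ℝ))).1 + 1, (x + k.2 • ((0:ℝ), (1:ℝ))).2) := by ext <;> simp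
    have e2 : ((x.1, x.2 + 1) : ℝ × ℝ) + k.2 • (0, 1) =
        ((x + k.2 • ((0:ℝ), (1:ℝ))).1, (x + k.2 • ((0:ℝ), (1:ℝ))).2 + 1) := by
      ext <;> simp; ring
    simp only [e1, e2, (hwp _).1, (hwp _).2, and_self]
  rw [← lintegral_translate (hm _) hper (k.1 • (1, 0))] at h2
  rw [add_mul, ENNReal.ofReal_add (by positivity) (by positivity)]
  refine le_trans ?_ (add_le_add h1 h2)
  rw [← lintegral_add_left (hm _)]
  refine lintegral_mono fun x => ?_
  rw [← ENNReal.ofReal_add (abs_nonneg _) (abs_nonneg _)]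
  refine ENNReal.ofReal_le_ofReal ?_
  have hk : x + k.1 • ((1:ℝ), (0:ℝ)) + k.2 • ((0:ℝ), (1:ℝ)) = x + k := by ext <;> simp
  rw [hk, add_comm |_|]
  exact abs_sub_le (w (x + k)) (w (x + k.1 • (1, 0))) (w x)

lemma sum_lintegral_Ico (F : ℝ → ℝ≥0∞) {δ : ℝ} (hδ : 0 ≤ δ) (n : ℕ) :
    ∑ i ∈ Finset.range n, ∫⁻ t in Set.Ico 0 δ, F (i * δ + t) = ∫⁻ t in Set.Ico 0 (n * δ), F t := by
  induction n with
  | zero => simp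
  | succ n ih =>
    have h1 : ∫⁻ t in Set.Ico 0 δ, F (n * δ + t) =
        ∫⁻ t in Set.Ico (n * δ) ((n + 1 : ℕ) * δ), F t := by
      have := (measurePreserving_add_left volume (n * δ)).setLIntegral_comp_preimage_emb
        (measurableEmbedding_addLeft _) F (Set.Ico (n * δ) ((n + 1 : ℕ) * δ))
      rw [← this, Set.preimage_const_add_Ico]
      congr 3 <;> push_cast <;> ring_nf
    have h2 : Set.Ico 0 ((n + 1 : ℕ) * δ) =
        Set.Ico 0 (n * δ) ∪ Set.Ico (n * δ) ((n + 1 : ℕ) * δ) := by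
      rw [Set.Ico_union_Ico_eq_Ico (by positivity)]
      push_cast
      nlinarith
    rw [Finset.sum_range_succ, ih, h1, h2, lintegral_union measurableSet_Ico]
    exact Set.disjoint_left.2 fun x hx hx' => not_lt.2 hx'.1 hx.2

/-- The square `[0, δ)²`. -/
def cellBox (δ : ℝ) : Set (ℝ × ℝ) := Set.Ico 0 δ ×ˢ Set.Ico 0 δ

lemma measurableSet_cellBox (δ : ℝ) : MeasurableSet (cellBox δ) :=
  measurableSet_Ico.prod measurableSet_Ico

lemma volume_cellBox {δ : ℝ} (hδ : 0 ≤ δ) : volume (cellBox δ) = ENNReal.ofReal (δ ^ 2) := by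
  rw [cellBox, Measure.volume_eq_prod, Measure.prod_prod, Real.volume_Ico, sub_zero,
    ← ENNReal.ofReal_mul hδ, sq]

lemma sum_lintegral_cellBox {F : ℝ × ℝ → ℝ≥0∞} (hF : Measurable F) {N : ℕ} (hN : 0 < N) :
    ∑ i ∈ Finset.range N, ∑ j ∈ Finset.range N, ∫⁻ z in cellBox (N:ℝ)⁻¹,
      F ((i * (N:ℝ)⁻¹, j * (N:ℝ)⁻¹) + z) = ∫⁻ x, F x ∂μT := by
  have hN' : (N:ℝ) * (N:ℝ)⁻¹ = 1 := mul_inv_cancel₀ (by positivity)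
  have hδ : 0 ≤ (N:ℝ)⁻¹ := by positivity
  have hcell : ∀ i j : ℕ, ∫⁻ z in cellBox (N:ℝ)⁻¹, F ((i * (N:ℝ)⁻¹, j * (N:ℝ)⁻¹) + z) =
      ∫⁻ s in Set.Ico 0 (N:ℝ)⁻¹, ∫⁻ t in Set.Ico 0 (N:ℝ)⁻¹,
        F (i * (N:ℝ)⁻¹ + s, j * (N:ℝ)⁻¹ + t) := fun i j => by
    rw [cellBox, Measure.volume_eq_prod, ← Measure.prod_restrict,
      lintegral_prod _ (Measurable.aemeasurable (by fun_prop))]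
    simp
  have hrow : ∀ i : ℕ, ∑ j ∈ Finset.range N,
      ∫⁻ z in cellBox (N:ℝ)⁻¹, F ((i * (N:ℝ)⁻¹, j * (N:ℝ)⁻¹) + z) =
      ∫⁻ s in Set.Ico 0 (N:ℝ)⁻¹, ∫⁻ t in Set.Ico (0:ℝ) 1, F (i * (N:ℝ)⁻¹ + s, t) := fun i => by
    simp only [hcell]
    have hm : ∀ j : ℕ, Measurable fun s => ∫⁻ t in Set.Ico 0 (N:ℝ)⁻¹,
        F (i * (N:ℝ)⁻¹ + s, j * (N:ℝ)⁻¹ + t) := fun j => Measurable.lintegral_prod_right'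
      (f := fun p : ℝ × ℝ => F (i * (N:ℝ)⁻¹ + p.1, j * (N:ℝ)⁻¹ + p.2)) (by fun_prop)
    rw [← lintegral_finsetSum _ fun j _ => hm j]
    refine lintegral_congr fun s => ?_
    rw [sum_lintegral_Ico (fun t => F (i * (N:ℝ)⁻¹ + s, t)) hδ, hN']
  simp only [hrow]
  rw [sum_lintegral_Ico (fun s => ∫⁻ t in Set.Ico (0:ℝ) 1, F (s, t)) hδ, hN', lintegral_μT hF]

/-- The grid values of `w` sampled at the grid points shifted by `z`. -/
def sampleGrid (w : ℝ × ℝ → ℝ) (N : ℕ) (z : ℝ × ℝ) : ℕ → ℕ → ℝ :=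
  fun i j => w ((i * (N:ℝ)⁻¹, j * (N:ℝ)⁻¹) + z)

lemma mod_succ_cases {N i : ℕ} (hi : i < N) :
    (i + 1) % N = i + 1 ∨ ((i + 1) % N = 0 ∧ i + 1 = N) := by
  rcases Nat.lt_or_ge (i + 1) N with h | h
  · exact Or.inl (Nat.mod_eq_of_lt h)
  · have : i + 1 = N := by omega
    exact Or.inr ⟨by rw [this, Nat.mod_self], this⟩

lemma sampleGrid_mod_left {w : ℝ × ℝ → ℝ} (hwp : Periodic2 w) {N i : ℕ} (hi : i < N) (j : ℕ)
    (z : ℝ × ℝ) : sampleGrid w N z ((i + 1) % N) j =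
      w ((i * (N:ℝ)⁻¹, j * (N:ℝ)⁻¹) + z + (N:ℝ)⁻¹ • (1, 0)) := by
  have hN : (N:ℝ) ≠ 0 := by
    have : 0 < N := by omega
    positivity
  rcases mod_succ_cases hi with h | ⟨h, h'⟩
  · rw [h, sampleGrid]
    congr 1
    ext <;> simp; ring
  · rw [h, sampleGrid, ← (hwp _).1]
    congr 1
    have hi' : (i:ℝ) = N - 1 := by rw [← h']; simp
    ext <;> simp
    rw [hi']; field_simp; ring

lemma sampleGrid_mod_right {w : ℝ × ℝ → ℝ} (hwp : Periodic2 w) {N j : ℕ} (hj : j < N) (i : ℕ)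
    (z : ℝ × ℝ) : sampleGrid w N z i ((j + 1) % N) =
      w ((i * (N:ℝ)⁻¹, j * (N:ℝ)⁻¹) + z + (N:ℝ)⁻¹ • (0, 1)) := by
  have hN : (N:ℝ) ≠ 0 := by
    have : 0 < N := by omega
    positivity
  rcases mod_succ_cases hj with h | ⟨h, h'⟩
  · rw [h, sampleGrid]
    congr 1
    ext <;> simp; ring
  · rw [h, sampleGrid, ← (hwp _).2]
    congr 1
    have hj' : (j:ℝ) = N - 1 := by rw [← h']; simp
    ext <;> simp
    rw [hj']; field_simp; ring

lemma ofReal_hEnergy_sampleGrid {w : ℝ × ℝ → ℝ} (hwp : Periodic2 w) (N : ℕ) (z : ℝ × ℝ) :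
    ENNReal.ofReal (hEnergy N (sampleGrid w N z)) = ENNReal.ofReal (N:ℝ)⁻¹ *
      ∑ i ∈ Finset.range N, ∑ j ∈ Finset.range N,
        (ENNReal.ofReal |w ((i * (N:ℝ)⁻¹, j * (N:ℝ)⁻¹) + z + (N:ℝ)⁻¹ • (1, 0)) -
            w ((i * (N:ℝ)⁻¹, j * (N:ℝ)⁻¹) + z)| +
          ENNReal.ofReal |w ((i * (N:ℝ)⁻¹, j * (N:ℝ)⁻¹) + z + (N:ℝ)⁻¹ • (0, 1)) -
            w ((i * (N:ℝ)⁻¹, j * (N:ℝ)⁻¹) + z)|) := by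
  rw [hEnergy, ENNReal.ofReal_mul (by positivity),
    ENNReal.ofReal_sum_of_nonneg fun i _ => by positivity]
  congr 1
  refine Finset.sum_congr rfl fun i hi => ?_
  rw [ENNReal.ofReal_sum_of_nonneg fun i _ => by positivity]
  refine Finset.sum_congr rfl fun j hj => ?_
  rw [sampleGrid_mod_left hwp (Finset.mem_range.1 hi),
    sampleGrid_mod_right hwp (Finset.mem_range.1 hj),
    ENNReal.ofReal_add (abs_nonneg _) (abs_nonneg _)]
  rfl

lemma measurable_hEnergy_sampleGrid {w : ℝ × ℝ → ℝ} (hw : Measurable w) (N : ℕ) :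
    Measurable fun z => hEnergy N (sampleGrid w N z) := by
  have hs : ∀ i j, Measurable fun z => sampleGrid w N z i j := fun i j => by
    unfold sampleGrid
    fun_prop
  unfold hEnergy
  refine Measurable.const_mul ?_ _
  refine Finset.measurable_fun_sum _ fun i _ => Finset.measurable_fun_sum _ fun j _ => ?_
  exact ((hs _ _).sub (hs _ _)).abs.add ((hs _ _).sub (hs _ _)).abs

lemma lintegral_hEnergy_sampleGrid_le {w : ℝ × ℝ → ℝ} (hw : Measurable w)
    (hw01 : ∀ x, 0 ≤ w x ∧ w x ≤ 1) (hwp : Periodic2 w) {c : ℝ}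
    (hc : ∀ v : ℝ × ℝ → ℝ × ℝ, ContDiff ℝ 1 v → Periodic2 v →
      (∀ x, |(v x).1| ≤ 1 ∧ |(v x).2| ≤ 1) → ∫ x, w x * div2 v x ∂μT ≤ c)
    {N : ℕ} (hN : 0 < N) :
    ∫⁻ z in cellBox (N:ℝ)⁻¹, ENNReal.ofReal (hEnergy N (sampleGrid w N z)) ≤
      ENNReal.ofReal ((N:ℝ)⁻¹ ^ 2 * c) := by
  have hm : ∀ e : ℝ × ℝ, Measurable fun x => ENNReal.ofReal |w (x + e) - w x| := fun e =>
    (by fun_prop : Measurable fun x => w (x + e) - w x).abs.ennreal_ofReal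
  have hm2 : Measurable fun x => ENNReal.ofReal |w (x + (N:ℝ)⁻¹ • (1, 0)) - w x| +
    ENNReal.ofReal |w (x + (N:ℝ)⁻¹ • (0, 1)) - w x| := (hm _).add (hm _)
  have hm3 : ∀ p : ℝ × ℝ, Measurable fun z =>
      ENNReal.ofReal |w (p + z + (N:ℝ)⁻¹ • (1, 0)) - w (p + z)| +
      ENNReal.ofReal |w (p + z + (N:ℝ)⁻¹ • (0, 1)) - w (p + z)| := fun p =>
    hm2.comp (measurable_const_add p)
  simp only [ofReal_hEnergy_sampleGrid hwp]
  rw [lintegral_const_mul _ (Finset.measurable_fun_sum _ fun i _ =>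
      Finset.measurable_fun_sum _ fun j _ => hm3 _),
    lintegral_finsetSum _ fun i _ => Finset.measurable_fun_sum _ fun j _ => hm3 _]
  simp only [lintegral_finsetSum _ fun j _ => hm3 _]
  rw [sum_lintegral_cellBox hm2 hN, lintegral_add_left (hm _), sq, mul_assoc,
    ENNReal.ofReal_mul (by positivity)]
  gcongr
  have := lintegral_abs_translate_sub_le hw hw01 hwp hc (N:ℝ)⁻¹
  rwa [abs_of_nonneg (by positivity : (0:ℝ) ≤ (N:ℝ)⁻¹)] at this

lemma gridIdx_bounds {N : ℕ} (hN : 0 < N) {t : ℝ} (ht : t ∈ Set.Ico (0:ℝ) 1) :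
    (gridIdx N t : ℝ) * (N:ℝ)⁻¹ ≤ t ∧ t < gridIdx N t * (N:ℝ)⁻¹ + (N:ℝ)⁻¹ := by
  have hN' : (0:ℝ) < N := by exact_mod_cast hN
  have hf : Int.fract t = t := Int.fract_eq_self.2 ht
  have h0 : (0:ℤ) ≤ ⌊t * N⌋ := Int.floor_nonneg.2 (mul_nonneg ht.1 hN'.le)
  have hc : (gridIdx N t : ℝ) = (⌊t * N⌋ : ℝ) := by
    rw [gridIdx, hf]
    exact_mod_cast Int.toNat_of_nonneg h0
  rw [hc]
  constructor
  · rw [← div_eq_mul_inv, div_le_iff₀ hN']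
    exact Int.floor_le _
  · have := Int.lt_floor_add_one (t * N)
    rw [← lt_div_iff₀ hN', add_div] at this
    rwa [← div_eq_mul_inv, inv_eq_one_div]

lemma measurable_extendGrid_sampleGrid {w : ℝ × ℝ → ℝ} (hw : Measurable w) (N : ℕ) :
    Measurable fun p : (ℝ × ℝ) × (ℝ × ℝ) =>
      ENNReal.ofReal |extendGrid N (sampleGrid w N p.1) p.2 - w p.2| := by
  have hg : Measurable fun t => (gridIdx N t : ℝ) := measurable_from_top.comp (measurable_gridIdx N)
  have h1 : Measurable fun p : (ℝ × ℝ) × (ℝ × ℝ) => (gridIdx N p.2.1 : ℝ) :=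
    hg.comp measurable_snd.fst
  have h2 : Measurable fun p : (ℝ × ℝ) × (ℝ × ℝ) => (gridIdx N p.2.2 : ℝ) :=
    hg.comp measurable_snd.snd
  have : Measurable fun p : (ℝ × ℝ) × (ℝ × ℝ) =>
      w ((gridIdx N p.2.1 * (N:ℝ)⁻¹, gridIdx N p.2.2 * (N:ℝ)⁻¹) + p.1) - w p.2 := by
    fun_prop
  exact this.abs.ennreal_ofReal

lemma lintegral_extendGrid_sampleGrid_le {w : ℝ × ℝ → ℝ} (hw : Measurable w)
    (hw01 : ∀ x, 0 ≤ w x ∧ w x ≤ 1) (hwp : Periodic2 w) {c : ℝ} (hc0 : 0 ≤ c)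
    (hc : ∀ v : ℝ × ℝ → ℝ × ℝ, ContDiff ℝ 1 v → Periodic2 v →
      (∀ x, |(v x).1| ≤ 1 ∧ |(v x).2| ≤ 1) → ∫ x, w x * div2 v x ∂μT ≤ c)
    {N : ℕ} (hN : 0 < N) :
    ∫⁻ z in cellBox (N:ℝ)⁻¹, ∫⁻ x, ENNReal.ofReal
        |extendGrid N (sampleGrid w N z) x - w x| ∂μT ≤
      ENNReal.ofReal (8 * (N:ℝ)⁻¹ ^ 3 * c) := by
  set δ := (N:ℝ)⁻¹ with hδ
  have hδ0 : 0 ≤ δ := by positivity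
  set B : Set (ℝ × ℝ) := Set.Icc (-δ) δ ×ˢ Set.Icc (-δ) δ with hB
  have hBm : MeasurableSet B := measurableSet_Icc.prod measurableSet_Icc
  have hBv : volume B = ENNReal.ofReal (4 * δ ^ 2) := by
    rw [hB, Measure.volume_eq_prod, Measure.prod_prod, Real.volume_Icc,
      ← ENNReal.ofReal_mul (by linarith)]
    congr 1; ring
  have hHm : Measurable fun p : (ℝ × ℝ) × (ℝ × ℝ) => ENNReal.ofReal |w (p.1 + p.2) - w p.1| :=
    (by fun_prop : Measurable fun p : (ℝ × ℝ) × (ℝ × ℝ) =>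
      w (p.1 + p.2) - w p.1).abs.ennreal_ofReal
  calc ∫⁻ z in cellBox δ, ∫⁻ x, ENNReal.ofReal |extendGrid N (sampleGrid w N z) x - w x| ∂μT
      = ∫⁻ x, (∫⁻ z in cellBox δ,
          ENNReal.ofReal |extendGrid N (sampleGrid w N z) x - w x|) ∂μT :=
        lintegral_lintegral_swap (measurable_extendGrid_sampleGrid hw N).aemeasurable
    _ ≤ ∫⁻ x, (∫⁻ k in B, ENNReal.ofReal |w (x + k) - w x|) ∂μT := by
        refine lintegral_mono_ae ?_
        rw [μT]
        filter_upwards [ae_restrict_mem measurableSet_Q2] with x hx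
        set a : ℝ × ℝ := (gridIdx N x.1 * δ, gridIdx N x.2 * δ) - x with ha
        have hmp := (measurePreserving_add_left volume a).setLIntegral_comp_preimage_emb
          (measurableEmbedding_addLeft a) (fun k => ENNReal.ofReal |w (x + k) - w x|) B
        rw [← hmp]
        have hsub : cellBox δ ⊆ (fun z => a + z) ⁻¹' B := by
          intro z hz
          obtain ⟨h1, h2⟩ := gridIdx_bounds hN hx.1
          obtain ⟨h3, h4⟩ := gridIdx_bounds hN hx.2
          obtain ⟨⟨h5, h6⟩, h7, h8⟩ := hz
          rw [← hδ] at h1 h2 h3 h4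
          refine ⟨⟨?_, ?_⟩, ?_, ?_⟩ <;> simp [ha] <;> linarith
        refine le_trans (le_of_eq ?_) (lintegral_mono_set hsub)
        refine lintegral_congr fun z => ?_
        have : x + (a + z) = (gridIdx N x.1 * δ, gridIdx N x.2 * δ) + z := by
          rw [ha]; abel
        rw [this]
        rfl
    _ = ∫⁻ k in B, ∫⁻ x, ENNReal.ofReal |w (x + k) - w x| ∂μT :=
        lintegral_lintegral_swap hHm.aemeasurable
    _ ≤ ∫⁻ _ in B, ENNReal.ofReal (2 * δ * c) := by
        refine setLIntegral_mono' hBm fun k hk => ?_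
        refine (lintegral_abs_translate_sub_le' hw hw01 hwp hc0 hc k).trans
          (ENNReal.ofReal_le_ofReal ?_)
        gcongr
        linarith [abs_le.2 hk.1, abs_le.2 hk.2]
    _ = ENNReal.ofReal (8 * δ ^ 3 * c) := by
        rw [setLIntegral_const, hBv, ← ENNReal.ofReal_mul (by positivity)]
        congr 1; ring

/-- A good shift of the sampling grid exists, by averaging over all shifts. -/
lemma exists_grid {w : ℝ × ℝ → ℝ} (hw : Measurable w)
    (hw01 : ∀ x, w x = 0 ∨ w x = 1) (hwp : Periodic2 w) {c : ℝ} (hc0 : 0 ≤ c)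
    (hc : ∀ v : ℝ × ℝ → ℝ × ℝ, ContDiff ℝ 1 v → Periodic2 v →
      (∀ x, |(v x).1| ≤ 1 ∧ |(v x).2| ≤ 1) → ∫ x, w x * div2 v x ∂μT ≤ c)
    {N : ℕ} (hN : 0 < N) :
    ∃ g : ℕ → ℕ → ℝ, IsBinaryGrid N g ∧
      ENNReal.ofReal (hEnergy N g) ≤ ENNReal.ofReal (c + 8 * c / √N) ∧
      ∫⁻ x, ENNReal.ofReal |extendGrid N g x - w x| ∂μT ≤
        ENNReal.ofReal ((c + 8 * c / √N) / √N) := by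
  have hw01' : ∀ x, 0 ≤ w x ∧ w x ≤ 1 := fun x => by
    rcases hw01 x with h | h <;> rw [h] <;> norm_num
  have hN' : (0:ℝ) < N := by exact_mod_cast hN
  have hs : 0 < √(N:ℝ) := Real.sqrt_pos.2 hN'
  have hδ : 0 < (N:ℝ)⁻¹ := inv_pos.2 hN'
  have hE := lintegral_hEnergy_sampleGrid_le hw hw01' hwp hc hN
  have hL := lintegral_extendGrid_sampleGrid_le hw hw01' hwp hc0 hc hN
  have hEm : Measurable fun z => ENNReal.ofReal (hEnergy N (sampleGrid w N z)) :=
    (measurable_hEnergy_sampleGrid hw N).ennreal_ofReal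
  have hLm : Measurable fun z => ∫⁻ x, ENNReal.ofReal
      |extendGrid N (sampleGrid w N z) x - w x| ∂μT :=
    (measurable_extendGrid_sampleGrid hw N).lintegral_prod_right'
  obtain ⟨z, -, hz⟩ := exists_le_setLAverage (μ := volume) (s := cellBox (N:ℝ)⁻¹)
    (f := fun z => ENNReal.ofReal (hEnergy N (sampleGrid w N z)) + ENNReal.ofReal √N *
      ∫⁻ x, ENNReal.ofReal |extendGrid N (sampleGrid w N z) x - w x| ∂μT)
    (by rw [volume_cellBox hδ.le]; simpa using by positivity)
    (by rw [volume_cellBox hδ.le]; exact ENNReal.ofReal_ne_top)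
    (hEm.add (hLm.const_mul _)).aemeasurable
  rw [setLAverage_eq, lintegral_add_left hEm, lintegral_const_mul _ hLm,
    volume_cellBox hδ.le] at hz
  have hbd : ENNReal.ofReal (hEnergy N (sampleGrid w N z)) + ENNReal.ofReal √N *
      ∫⁻ x, ENNReal.ofReal |extendGrid N (sampleGrid w N z) x - w x| ∂μT ≤
      ENNReal.ofReal (c + 8 * c / √N) := by
    refine hz.trans ((ENNReal.div_le_div_right (add_le_add hE (mul_le_mul_right hL _)) _).trans ?_)
    rw [← ENNReal.ofReal_mul hs.le, ← ENNReal.ofReal_add (by positivity) (by positivity),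
      ← ENNReal.ofReal_div_of_pos (by positivity)]
    refine ENNReal.ofReal_le_ofReal (le_of_eq ?_)
    have hsq : (N:ℝ) = √N ^ 2 := (Real.sq_sqrt hN'.le).symm
    generalize √(N:ℝ) = s at hs hsq
    rw [hsq]
    field_simp
  refine ⟨sampleGrid w N z, fun i _ j _ => hw01 _, le_self_add.trans hbd, ?_⟩
  rw [ENNReal.ofReal_div_of_pos hs, ENNReal.le_div_iff_mul_le
    (Or.inl (by simpa using hs)) (Or.inl ENNReal.ofReal_ne_top), mul_comm]
  exact le_add_self.trans hbd

/-- A `{0,1}`-valued function on the torus has a measurable periodic `{0,1}`-valued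
representative. -/
lemma exists_periodic_representative {u : ℝ × ℝ → ℝ} (hu : AEStronglyMeasurable u μT)
    (hu01 : ∀ᵐ x ∂μT, u x = 0 ∨ u x = 1) :
    ∃ w : ℝ × ℝ → ℝ, Measurable w ∧ (∀ x, w x = 0 ∨ w x = 1) ∧ Periodic2 w ∧ u =ᵐ[μT] w := by
  have hA : MeasurableSet (hu.mk u ⁻¹' {1}) := hu.measurable_mk (measurableSet_singleton 1)
  have hfract : Measurable fun x : ℝ × ℝ => (Int.fract x.1, Int.fract x.2) := by fun_prop
  refine ⟨fun x => (hu.mk u ⁻¹' {1}).indicator (fun _ => 1) (Int.fract x.1, Int.fract x.2),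
    (measurable_const.indicator hA).comp hfract, fun x => ?_, fun x => ?_, ?_⟩
  · exact Set.indicator_eq_zero_or_self _ _ _
  · simp
  · have hQ : ∀ᵐ x ∂μT, x ∈ Q2 := ae_restrict_mem measurableSet_Q2
    filter_upwards [hu.ae_eq_mk, hu01, hQ] with x hx h01 hxQ
    rw [Int.fract_eq_self.2 hxQ.1, Int.fract_eq_self.2 hxQ.2]
    rcases h01 with h | h
    · rw [h, Set.indicator_of_notMem]
      simp [← hx, h]
    · rw [h, Set.indicator_of_mem]
      simp [← hx, h]

lemma integrable_extendGrid {N : ℕ} (hN : 0 < N) {g : ℕ → ℕ → ℝ} (hg : IsBinaryGrid N g) :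
    Integrable (extendGrid N g) μT := by
  refine Integrable.of_bound (measurable_extendGrid N g).aestronglyMeasurable 1
    (ae_of_all _ fun x => ?_)
  rcases hg _ (gridIdx_lt hN x.1) _ (gridIdx_lt hN x.2) with h | h <;> simp [extendGrid, h]

lemma hN0_extendGrid_le {N : ℕ} {g : ℕ → ℕ → ℝ} (hg : IsBinaryGrid N g) :
    hN0 N (extendGrid N g) ≤ ENNReal.ofReal (hEnergy N g) :=
  iInf₂_le g ⟨EventuallyEq.rfl, hg⟩

/-- Upper bound (UB) for the Γ-convergence `h_{N,0} → h_{∞,0}`: for every `u ∈ L¹(T²)` and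
`N_n → ∞` there is a recovery sequence `u_n → u` in `L¹(T²)` with
`limsup_n h_{N_n,0}(u_n) ≤ h_{∞,0}(u)`. -/
theorem upper_bound_hN0 (u : ℝ × ℝ → ℝ) (hu : Integrable u μT)
    (Nn : ℕ → ℕ) (hNn : Tendsto Nn atTop atTop) :
    ∃ U : ℕ → ℝ × ℝ → ℝ, (∀ n, Integrable (U n) μT) ∧ TendstoL1 U u ∧
      limsup (fun n => hN0 (Nn n) (U n)) atTop ≤ hInf0 u := by
  by_cases hV : hInf0 u = ⊤
  · exact ⟨fun _ => u, fun _ => hu, by simp [TendstoL1], by rw [hV]; exact le_top⟩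
  have hBV : BV01 u := by
    by_contra h
    exact hV (if_neg h)
  have hval : hInf0 u = anisoTV u := if_pos hBV
  rw [hval] at hV ⊢
  obtain ⟨w, hw, hw01, hwp, huw⟩ := exists_periodic_representative hBV.1 hBV.2.1
  have hc : ∀ v : ℝ × ℝ → ℝ × ℝ, ContDiff ℝ 1 v → Periodic2 v →
      (∀ x, |(v x).1| ≤ 1 ∧ |(v x).2| ≤ 1) →
      ∫ x, w x * div2 v x ∂μT ≤ (anisoTV u).toReal := by
    intro v hv1 hv2 hv3
    have h1 : ∫ x, w x * div2 v x ∂μT = ∫ x, u x * div2 v x ∂μT := by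
      refine integral_congr_ae ?_
      filter_upwards [huw] with x hx
      rw [hx]
    have h2 : ENNReal.ofReal (∫ x, u x * div2 v x ∂μT) ≤ anisoTV u :=
      le_iSup₂_of_le v ⟨hv1, hv2, hv3⟩ le_rfl
    rw [h1]
    exact (ENNReal.ofReal_le_iff_le_toReal hV).1 h2
  set c := (anisoTV u).toReal with hcdef
  have hex : ∀ N : ℕ, ∃ f : ℝ × ℝ → ℝ, Integrable f μT ∧ (0 < N →
      hN0 N f ≤ ENNReal.ofReal (c + 8 * c / √N) ∧
      ∫⁻ x, ENNReal.ofReal |f x - u x| ∂μT ≤ ENNReal.ofReal ((c + 8 * c / √N) / √N)) := by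
    intro N
    rcases Nat.eq_zero_or_pos N with rfl | hN
    · exact ⟨u, hu, fun h => absurd h (lt_irrefl 0)⟩
    obtain ⟨g, hg, hgE, hgL⟩ := exists_grid hw hw01 hwp ENNReal.toReal_nonneg hc hN
    refine ⟨extendGrid N g, integrable_extendGrid hN hg, fun _ =>
      ⟨(hN0_extendGrid_le hg).trans hgE, le_trans (le_of_eq (lintegral_congr_ae ?_)) hgL⟩⟩
    filter_upwards [huw] with x hx
    rw [hx]
  choose f hfi hf using hex
  have hsqrt : Tendsto (fun n => √(Nn n : ℝ)) atTop atTop :=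
    Real.tendsto_sqrt_atTop.comp (tendsto_natCast_atTop_atTop.comp hNn)
  have hbE : Tendsto (fun n => c + 8 * c / √(Nn n : ℝ)) atTop (𝓝 c) := by
    simpa using (hsqrt.const_div_atTop (8 * c)).const_add c
  have hbL : Tendsto (fun n => (c + 8 * c / √(Nn n : ℝ)) / √(Nn n : ℝ)) atTop (𝓝 0) :=
    hbE.div_atTop hsqrt
  have hpos : ∀ᶠ n in atTop, 0 < Nn n := hNn.eventually_gt_atTop 0
  refine ⟨fun n => f (Nn n), fun n => hfi _, ?_, ?_⟩
  · have hb := ENNReal.tendsto_ofReal hbL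
    rw [ENNReal.ofReal_zero] at hb
    exact tendsto_of_tendsto_of_tendsto_of_le_of_le' tendsto_const_nhds hb
      (Eventually.of_forall fun _ => zero_le) (hpos.mono fun n hn => (hf _ hn).2)
  · have hb := ENNReal.tendsto_ofReal hbE
    rw [hcdef, ENNReal.ofReal_toReal hV] at hb
    rw [← hb.limsup_eq]
    exact limsup_le_limsup (hpos.mono fun n hn => (hf _ hn).1)

end
end
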